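/- arXiv:2108.11639 — 2 statements merged into one kernel-verified Lean document; each statement's English description precedes it below -/
import Mathlib

section
/- Let $n\ge 1$ and let $(M,g)$ be a smooth Riemannian manifold of dimension $2n+1$ with Levi-Civita connection $\nabla$, Ricci tensor $S$ and scalar curvature $r$. Suppose that $M$ carries a smooth $(1,1)$-tensor field $\phi$, a smooth vector field $\xi$ and a $1$-form $\eta$ that make it a Kenmotsu manifold, i.e. for all vector fields $X,Y$ $$\phi^2X=-X+\eta(X)\xi,\qquad \eta(\xi)=1,\qquad \eta(X)=g(X,\xi),\qquad g(\phi X,\phi Y)=g(X,Y)-\eta(X)\eta(Y),$$ $$(\nabla_X\phi)Y=g(\phi X,Y)\,\xi-\eta(Y)\,\phi X.$$ Suppose that $M$ is $\eta$-Einstein, i.e. $S=\alpha g+\beta\,\eta\otimes\eta$ for some smooth functions $\alpha,\beta$ on $M$. Suppose that $(g,V,\lambda,\mu)$ is a conformal $\eta$-Ricci soliton on $M$, i.e. $V$ is a smooth vector field, $\lambda,\mu$ are real constants, and for some real constant $p$ (the conformal pressure) $$\mathcal L_Vg+2S+\Bigl[2\lambda-\Bigl(p+\frac{2}{2n+1}\Bigr)\Bigr]g+2\mu\,\eta\otimes\eta=0.$$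 Then $M$ is Einstein, i.e. $S=\alpha' g$ for some smooth function $\alpha'$ on $M$; more precisely, $S=\bigl(\frac{r}{2n}+1\bigr)g$. -/
open Bundle Module VectorField
open scoped Manifold ContDiff

noncomputable section

namespace KenmotsuGeometry

section Riemannian

variable {E : Type*} [NormedAddCommGroup E] [NormedSpace ℝ E] [FiniteDimensional ℝ E]
  {M : Type*} [TopologicalSpace M] [ChartedSpace E M] [IsManifold 𝓘(ℝ, E) ∞ M]

set_option linter.unusedSectionVars false

variable (E M) in
/-- A smooth Riemannian metric on the smooth manifold `M` modelled on `E`. -/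
abbrev Metric : Type _ :=
  ContMDiffRiemannianMetric 𝓘(ℝ, E) ∞ E (fun x : M ↦ TangentSpace 𝓘(ℝ, E) x)

variable (E) in
/-- The vector field `X` (a section of the tangent bundle) is differentiable at `x`. -/
abbrev DiffFieldAt (X : Π x : M, TangentSpace 𝓘(ℝ, E) x) (x : M) : Prop :=
  MDifferentiableAt 𝓘(ℝ, E) 𝓘(ℝ, E).tangent (fun y ↦ (⟨y, X y⟩ : TangentBundle 𝓘(ℝ, E) M)) x

variable (E) in
/-- The vector field `X` (a section of the tangent bundle) is smooth. -/
abbrev SmoothField (X : Π x : M, TangentSpace 𝓘(ℝ, E) x) : Prop :=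
  ContMDiff 𝓘(ℝ, E) 𝓘(ℝ, E).tangent ∞ (fun y ↦ (⟨y, X y⟩ : TangentBundle 𝓘(ℝ, E) M))

/-- The function `g(X, Y)`. -/
abbrev pair (g : Metric E M) (X Y : Π x : M, TangentSpace 𝓘(ℝ, E) x) : M → ℝ :=
  fun x ↦ g.inner x (X x) (Y x)

theorem pair_comm (g : Metric E M) (X Y : Π x : M, TangentSpace 𝓘(ℝ, E) x) :
    pair g X Y = pair g Y X := funext fun x ↦ g.symm x _ _

theorem mdifferentiableAt_pair (g : Metric E M) {X Y : Π x : M, TangentSpace 𝓘(ℝ, E) x} {x : M}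
    (hX : DiffFieldAt E X x) (hY : DiffFieldAt E Y x) :
    MDifferentiableAt 𝓘(ℝ, E) 𝓘(ℝ, ℝ) (pair g X Y) x := by
  let _ : RiemannianBundle (fun x : M ↦ TangentSpace 𝓘(ℝ, E) x) := ⟨g.toRiemannianMetric⟩
  exact MDifferentiableAt.inner_bundle (E := fun x : M ↦ TangentSpace 𝓘(ℝ, E) x) (b := id) hX hY

/-- The isomorphism `v ↦ g(v, ·)` from the tangent space to its dual. -/
def flat (g : Metric E M) (x : M) :
    TangentSpace 𝓘(ℝ, E) x ≃ₗ[ℝ] (TangentSpace 𝓘(ℝ, E) x →L[ℝ] ℝ) :=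
  haveI : FiniteDimensional ℝ (TangentSpace 𝓘(ℝ, E) x) := inferInstanceAs (FiniteDimensional ℝ E)
  haveI : T2Space (TangentSpace 𝓘(ℝ, E) x) := inferInstanceAs (T2Space E)
  LinearMap.linearEquivOfInjective (g.inner x).toLinearMap
    (by
      rw [← LinearMap.ker_eq_bot, LinearMap.ker_eq_bot']
      intro v hv
      by_contra h
      have := g.pos x v h
      simp_all)
    (by
      rw [← LinearEquiv.finrank_eq (LinearMap.toContinuousLinearMap (𝕜 := ℝ)
        (E := TangentSpace 𝓘(ℝ, E) x) (F' := ℝ))]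
      exact (Subspace.dual_finrank_eq).symm)

@[simp]
theorem flat_apply (g : Metric E M) (x : M) (v w : TangentSpace 𝓘(ℝ, E) x) :
    flat g x v w = g.inner x v w := rfl

/-- The right-hand side of the Koszul formula, `g(∇_X Y, Z)` at `x`. -/
def koszul (g : Metric E M) (X Y Z : Π x : M, TangentSpace 𝓘(ℝ, E) x) (x : M) : ℝ :=
  (mvfderiv 𝓘(ℝ, E) (pair g Y Z) x (X x) + mvfderiv 𝓘(ℝ, E) (pair g Z X) x (Y x)
    - mvfderiv 𝓘(ℝ, E) (pair g X Y) x (Z x)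
    + g.inner x (mlieBracket 𝓘(ℝ, E) X Y x) (Z x)
    - g.inner x (mlieBracket 𝓘(ℝ, E) Y Z x) (X x)
    + g.inner x (mlieBracket 𝓘(ℝ, E) Z X x) (Y x)) / 2

theorem pair_smul_left (g : Metric E M) (f : M → ℝ) (X Y : Π x : M, TangentSpace 𝓘(ℝ, E) x) :
    pair g (f • X) Y = f * pair g X Y := by
  ext x; simp [pair]

theorem pair_smul_right (g : Metric E M) (f : M → ℝ) (X Y : Π x : M, TangentSpace 𝓘(ℝ, E) x) :
    pair g X (f • Y) = f * pair g X Y := by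
  ext x; simp [pair]

theorem pair_add_left (g : Metric E M) (X X' Y : Π x : M, TangentSpace 𝓘(ℝ, E) x) :
    pair g (X + X') Y = pair g X Y + pair g X' Y := by
  ext x; simp [pair]

theorem pair_add_right (g : Metric E M) (X Y Y' : Π x : M, TangentSpace 𝓘(ℝ, E) x) :
    pair g X (Y + Y') = pair g X Y + pair g X Y' := by
  ext x; simp [pair]

theorem koszul_tensorial_left (g : Metric E M) {Y Z : Π x : M, TangentSpace 𝓘(ℝ, E) x} {x : M}
    (hY : DiffFieldAt E Y x) (hZ : DiffFieldAt E Z x) :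
    TensorialAt 𝓘(ℝ, E) E (fun X : Π x : M, TangentSpace 𝓘(ℝ, E) x ↦ koszul g X Y Z x) x where
  smul {f X} hf hX := by
    simp only [koszul, pair_smul_left, pair_smul_right,
      mvfderiv_mul hf (mdifferentiableAt_pair g hZ hX),
      mvfderiv_mul hf (mdifferentiableAt_pair g hX hY), mlieBracket_smul_left hf hX,
      mlieBracket_smul_right hf hX]
    simp [pair, g.symm x (X x)]
    ring
  add {X X'} hX hX' := by
    simp only [koszul, pair_add_left, pair_add_right,
      mvfderiv_add (mdifferentiableAt_pair g hZ hX) (mdifferentiableAt_pair g hZ hX'),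
      mvfderiv_add (mdifferentiableAt_pair g hX hY) (mdifferentiableAt_pair g hX' hY),
      mlieBracket_add_left hX hX', mlieBracket_add_right hX hX']
    simp
    ring

theorem koszul_tensorial_right (g : Metric E M) {X Y : Π x : M, TangentSpace 𝓘(ℝ, E) x} {x : M}
    (hX : DiffFieldAt E X x) (hY : DiffFieldAt E Y x) :
    TensorialAt 𝓘(ℝ, E) E (fun Z : Π x : M, TangentSpace 𝓘(ℝ, E) x ↦ koszul g X Y Z x) x where
  smul {f Z} hf hZ := by
    simp only [koszul, pair_smul_left, pair_smul_right,
      mvfderiv_mul hf (mdifferentiableAt_pair g hZ hX),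
      mvfderiv_mul hf (mdifferentiableAt_pair g hY hZ), mlieBracket_smul_left hf hZ,
      mlieBracket_smul_right hf hZ]
    simp [pair, g.symm x (Z x)]
    ring
  add {Z Z'} hZ hZ' := by
    simp only [koszul, pair_add_left, pair_add_right,
      mvfderiv_add (mdifferentiableAt_pair g hZ hX) (mdifferentiableAt_pair g hZ' hX),
      mvfderiv_add (mdifferentiableAt_pair g hY hZ) (mdifferentiableAt_pair g hY hZ'),
      mlieBracket_add_left hZ hZ', mlieBracket_add_right hZ hZ']
    simp
    ring

theorem koszul_add_middle (g : Metric E M) {X Y Y' Z : Π x : M, TangentSpace 𝓘(ℝ, E) x} {x : M}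
    (hX : DiffFieldAt E X x) (hY : DiffFieldAt E Y x) (hY' : DiffFieldAt E Y' x)
    (hZ : DiffFieldAt E Z x) :
    koszul g X (Y + Y') Z x = koszul g X Y Z x + koszul g X Y' Z x := by
  simp only [koszul, pair_add_left, pair_add_right,
    mvfderiv_add (mdifferentiableAt_pair g hY hZ) (mdifferentiableAt_pair g hY' hZ),
    mvfderiv_add (mdifferentiableAt_pair g hX hY) (mdifferentiableAt_pair g hX hY'),
    mlieBracket_add_left hY hY', mlieBracket_add_right hY hY']
  simp
  ring

theorem koszul_smul_middle (g : Metric E M) {X Y Z : Π x : M, TangentSpace 𝓘(ℝ, E) x}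
    {f : M → ℝ} {x : M} (hf : MDifferentiableAt 𝓘(ℝ, E) 𝓘(ℝ, ℝ) f x)
    (hX : DiffFieldAt E X x) (hY : DiffFieldAt E Y x) (hZ : DiffFieldAt E Z x) :
    koszul g X (f • Y) Z x =
      f x * koszul g X Y Z x + mvfderiv 𝓘(ℝ, E) f x (X x) * g.inner x (Y x) (Z x) := by
  simp only [koszul, pair_smul_left, pair_smul_right,
    mvfderiv_mul hf (mdifferentiableAt_pair g hY hZ),
    mvfderiv_mul hf (mdifferentiableAt_pair g hX hY),
    mlieBracket_smul_left hf hY, mlieBracket_smul_right hf hY]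
  simp [pair, g.symm x (X x)]
  ring

open scoped Classical in
/-- The form `(v, z) ↦ g(∇_v Y, z)` at `x`, from the Koszul formula (zero by convention where `Y`
is not differentiable). -/
def koszulForm (g : Metric E M) (Y : Π x : M, TangentSpace 𝓘(ℝ, E) x) (x : M) :
    TangentSpace 𝓘(ℝ, E) x →L[ℝ] TangentSpace 𝓘(ℝ, E) x →L[ℝ] ℝ :=
  if hY : DiffFieldAt E Y x then
    TensorialAt.mkHom₂ (I := 𝓘(ℝ, E)) (F := E) (F' := E) (fun X Z ↦ koszul g X Y Z x) x
      (fun _ hZ ↦ koszul_tensorial_left g hY hZ) (fun _ hX ↦ koszul_tensorial_right g hX hY)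
  else 0

theorem koszulForm_apply (g : Metric E M) {X Y Z : Π x : M, TangentSpace 𝓘(ℝ, E) x} {x : M}
    (hX : DiffFieldAt E X x) (hY : DiffFieldAt E Y x) (hZ : DiffFieldAt E Z x) :
    koszulForm g Y x (X x) (Z x) = koszul g X Y Z x := by
  rw [koszulForm, dif_pos hY]
  exact TensorialAt.mkHom₂_apply _ _ hX hZ

theorem koszulForm_apply_extend (g : Metric E M) {Y : Π x : M, TangentSpace 𝓘(ℝ, E) x} {x : M}
    (hY : DiffFieldAt E Y x) (v z : TangentSpace 𝓘(ℝ, E) x) :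
    koszulForm g Y x v z =
      koszul g (FiberBundle.extend E v) Y (FiberBundle.extend E z) x := by
  rw [koszulForm, dif_pos hY]
  rfl

/-- The Levi-Civita connection of `g`: `∇_v Y` is the vector with
`g(∇_v Y, z) = koszulForm g Y x v z` for all `z`. On paper, `leviCivita g Y x (X x)` is
`(∇_X Y)(x)`. -/
def leviCivita (g : Metric E M) :
    CovariantDerivative 𝓘(ℝ, E) E (fun x : M ↦ TangentSpace 𝓘(ℝ, E) x) where
  toFun Y x :=
    haveI : FiniteDimensional ℝ (TangentSpace 𝓘(ℝ, E) x) :=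
      inferInstanceAs (FiniteDimensional ℝ E)
    haveI : T2Space (TangentSpace 𝓘(ℝ, E) x) := inferInstanceAs (T2Space E)
    LinearMap.toContinuousLinearMap ((flat g x).symm.toLinearMap ∘ₗ (koszulForm g Y x).toLinearMap)
  isCovariantDerivativeOnUniv :=
    { add := by
        intro Y Y' x hY hY' _
        ext1 v
        apply (flat g x).injective
        ext z
        have h := mdifferentiableAt_add_section hY hY'
        simp only [LinearMap.coe_toContinuousLinearMap', LinearMap.comp_apply,
          _root_.add_apply, map_add, LinearEquiv.coe_coe, LinearEquiv.apply_symm_apply,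
          ContinuousLinearMap.coe_coe]
        rw [koszulForm_apply_extend g hY, koszulForm_apply_extend g hY',
          koszulForm_apply_extend g h]
        exact koszul_add_middle g (FiberBundle.mdifferentiableAt_extend ..) hY hY'
          (FiberBundle.mdifferentiableAt_extend ..)
      leibniz := by
        intro Y f x hY hf _
        ext1 v
        apply (flat g x).injective
        ext z
        have h := hf.smul_section hY
        simp only [LinearMap.coe_toContinuousLinearMap', LinearMap.comp_apply,
          _root_.add_apply, map_add, LinearEquiv.coe_coe, LinearEquiv.apply_symm_apply,
          ContinuousLinearMap.coe_coe, _root_.smul_apply, map_smul,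
          ContinuousLinearMap.smulRight_apply]
        rw [koszulForm_apply_extend g hY, koszulForm_apply_extend g h]
        have := koszul_smul_middle g hf (FiberBundle.mdifferentiableAt_extend (I := 𝓘(ℝ, E)) (F := E) v) hY
          (FiberBundle.mdifferentiableAt_extend (I := 𝓘(ℝ, E)) (F := E) z)
        simpa using this }

theorem inner_leviCivita (g : Metric E M) {X Y Z : Π x : M, TangentSpace 𝓘(ℝ, E) x} {x : M}
    (hX : DiffFieldAt E X x) (hY : DiffFieldAt E Y x) (hZ : DiffFieldAt E Z x) :
    g.inner x (leviCivita g Y x (X x)) (Z x) = koszul g X Y Z x := by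
  rw [← koszulForm_apply g hX hY hZ, ← flat_apply]
  exact congrArg (fun l ↦ l (Z x)) ((flat g x).apply_symm_apply (koszulForm g Y x (X x)))

/-- `leviCivita g` is torsion-free. -/
theorem leviCivita_torsion (g : Metric E M) : (leviCivita g).torsion = 0 := by
  rw [CovariantDerivative.torsion_eq_zero_iff]
  intro X Y x hX hY
  apply (flat g x).injective
  ext z
  obtain ⟨Z, hZ, rfl⟩ : ∃ Z : Π x : M, TangentSpace 𝓘(ℝ, E) x, DiffFieldAt E Z x ∧ Z x = z :=
    ⟨FiberBundle.extend E z, FiberBundle.mdifferentiableAt_extend .., by simp⟩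
  simp only [map_sub, _root_.sub_apply, flat_apply]
  rw [inner_leviCivita g hX hY hZ, inner_leviCivita g hY hX hZ]
  simp only [koszul, pair_comm g Z, pair_comm g Y X, mlieBracket_swap_apply (V := Y) (W := X),
    mlieBracket_swap_apply (V := Z), map_neg, _root_.neg_apply]
  ring

/-- `leviCivita g` is compatible with the metric. -/
theorem leviCivita_metric (g : Metric E M) {X Y Z : Π x : M, TangentSpace 𝓘(ℝ, E) x} {x : M}
    (hX : DiffFieldAt E X x) (hY : DiffFieldAt E Y x) (hZ : DiffFieldAt E Z x) :
    mvfderiv 𝓘(ℝ, E) (pair g Y Z) x (X x) =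
      g.inner x (leviCivita g Y x (X x)) (Z x) + g.inner x (Y x) (leviCivita g Z x (X x)) := by
  rw [g.symm x (Y x), inner_leviCivita g hX hY hZ, inner_leviCivita g hX hZ hY]
  simp only [koszul, pair_comm g Z, pair_comm g Y X, mlieBracket_swap_apply (V := Y) (W := X),
    mlieBracket_swap_apply (V := Z), map_neg, _root_.neg_apply]
  ring

/-- The curvature `R(X, Y)Z = ∇_X ∇_Y Z - ∇_Y ∇_X Z - ∇_[X, Y] Z` of the Levi-Civita connection. -/
def curvature (g : Metric E M) (X Y Z : Π x : M, TangentSpace 𝓘(ℝ, E) x) (x : M) :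
    TangentSpace 𝓘(ℝ, E) x :=
  leviCivita g (fun y ↦ leviCivita g Z y (Y y)) x (X x)
    - leviCivita g (fun y ↦ leviCivita g Z y (X y)) x (Y x)
    - leviCivita g Z x (mlieBracket 𝓘(ℝ, E) X Y x)

/-- The curvature tensor `R(u, v)w` on tangent vectors at `x`, computed with the vector fields that
extend `u`, `v`, `w` with constant coefficients in the chart at `x`. -/
def curvatureAt (g : Metric E M) (x : M) (u v w : TangentSpace 𝓘(ℝ, E) x) :
    TangentSpace 𝓘(ℝ, E) x :=
  curvature g (FiberBundle.extend E u) (FiberBundle.extend E v) (FiberBundle.extend E w) x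

variable (E) in
/-- A basis of the tangent space at `x`, used to write traces. -/
def tangentBasis (x : M) : Basis (Fin (finrank ℝ E)) ℝ (TangentSpace 𝓘(ℝ, E) x) :=
  finBasis ℝ E

/-- The Ricci tensor `S(v, w)`, the trace of `u ↦ R(u, v)w`. -/
def ricci (g : Metric E M) (x : M) (v w : TangentSpace 𝓘(ℝ, E) x) : ℝ :=
  ∑ i, (tangentBasis E x).coord i (curvatureAt g x (tangentBasis E x i) v w)

/-- The `g`-dual of `tangentBasis`: `g(e' i, e j)` is `1` if `i = j` and `0` otherwise. -/
def dualTangentBasis (g : Metric E M) (x : M) (i : Fin (finrank ℝ E)) : TangentSpace 𝓘(ℝ, E) x :=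
  haveI : FiniteDimensional ℝ (TangentSpace 𝓘(ℝ, E) x) := inferInstanceAs (FiniteDimensional ℝ E)
  haveI : T2Space (TangentSpace 𝓘(ℝ, E) x) := inferInstanceAs (T2Space E)
  (flat g x).symm (LinearMap.toContinuousLinearMap ((tangentBasis E x).coord i))

/-- The scalar curvature `r`, the `g`-trace of the Ricci tensor. -/
def scalarCurvature (g : Metric E M) (x : M) : ℝ :=
  ∑ i, ricci g x (tangentBasis E x i) (dualTangentBasis g x i)

/-- The Lie derivative `(L_V g)(X, Y) = V g(X, Y) - g([V, X], Y) - g(X, [V, Y])` at `x`. -/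
def lieDerivMetric (g : Metric E M) (V X Y : Π x : M, TangentSpace 𝓘(ℝ, E) x) (x : M) : ℝ :=
  mvfderiv 𝓘(ℝ, E) (pair g X Y) x (V x)
    - g.inner x (mlieBracket 𝓘(ℝ, E) V X x) (Y x)
    - g.inner x (X x) (mlieBracket 𝓘(ℝ, E) V Y x)

/-- `(φ, ξ, η, g)` is an almost contact metric structure on `M`. -/
structure IsAlmostContactMetric (g : Metric E M)
    (φ : Π x : M, TangentSpace 𝓘(ℝ, E) x →L[ℝ] TangentSpace 𝓘(ℝ, E) x)
    (ξ : Π x : M, TangentSpace 𝓘(ℝ, E) x) (η : Π x : M, TangentSpace 𝓘(ℝ, E) x →L[ℝ] ℝ) :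
    Prop where
  smooth_phi : ContMDiff 𝓘(ℝ, E) (𝓘(ℝ, E).prod 𝓘(ℝ, E →L[ℝ] E)) ∞
    (fun x ↦ TotalSpace.mk' (E →L[ℝ] E)
      (E := fun x : M ↦ TangentSpace 𝓘(ℝ, E) x →L[ℝ] TangentSpace 𝓘(ℝ, E) x) x (φ x))
  smooth_xi : SmoothField E ξ
  phi_phi : ∀ x v, φ x (φ x v) = -v + η x v • ξ x
  eta_xi : ∀ x, η x (ξ x) = 1
  -- in particular the 1-form `η` is smooth
  eta_eq : ∀ x v, η x v = g.inner x v (ξ x)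
  inner_phi_phi : ∀ x v w, g.inner x (φ x v) (φ x w) = g.inner x v w - η x v * η x w

/-- `(M, g, φ, ξ, η)` is a Kenmotsu manifold:
`(∇_X φ)Y = ∇_X (φY) - φ(∇_X Y) = g(φX, Y)ξ - η(Y)φX`. -/
structure IsKenmotsu (g : Metric E M)
    (φ : Π x : M, TangentSpace 𝓘(ℝ, E) x →L[ℝ] TangentSpace 𝓘(ℝ, E) x)
    (ξ : Π x : M, TangentSpace 𝓘(ℝ, E) x) (η : Π x : M, TangentSpace 𝓘(ℝ, E) x →L[ℝ] ℝ) :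
    Prop extends IsAlmostContactMetric g φ ξ η where
  nabla_phi : ∀ X Y : Π x : M, TangentSpace 𝓘(ℝ, E) x, ∀ x,
    DiffFieldAt E X x → DiffFieldAt E Y x →
    leviCivita g (fun y ↦ φ y (Y y)) x (X x) - φ x (leviCivita g Y x (X x)) =
      g.inner x (φ x (X x)) (Y x) • ξ x - η x (Y x) • φ x (X x)

/-- `M` is η-Einstein: `S = α g + β η ⊗ η` for smooth functions `α`, `β`. -/
def IsEtaEinstein (g : Metric E M) (η : Π x : M, TangentSpace 𝓘(ℝ, E) x →L[ℝ] ℝ) : Prop :=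
  ∃ α β : M → ℝ, ContMDiff 𝓘(ℝ, E) 𝓘(ℝ, ℝ) ∞ α ∧ ContMDiff 𝓘(ℝ, E) 𝓘(ℝ, ℝ) ∞ β ∧
    ∀ x v w, ricci g x v w = α x * g.inner x v w + β x * (η x v * η x w)

/-- `M` is Einstein: `S = α g` for a smooth function `α`. -/
def IsEinstein (g : Metric E M) : Prop :=
  ∃ α : M → ℝ, ContMDiff 𝓘(ℝ, E) 𝓘(ℝ, ℝ) ∞ α ∧ ∀ x v w, ricci g x v w = α x * g.inner x v w

/-- `(g, V, lam, mu)` is a conformal η-Ricci soliton with conformal pressure `p`: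
`L_V g + 2 S + [2 lam - (p + 2 / dim M)] g + 2 mu η ⊗ η = 0`. -/
structure IsConformalEtaRicciSoliton (g : Metric E M)
    (η : Π x : M, TangentSpace 𝓘(ℝ, E) x →L[ℝ] ℝ) (V : Π x : M, TangentSpace 𝓘(ℝ, E) x)
    (lam mu p : ℝ) : Prop where
  smooth : SmoothField E V
  equation : ∀ X Y : Π x : M, TangentSpace 𝓘(ℝ, E) x, ∀ x,
    DiffFieldAt E X x → DiffFieldAt E Y x →
    lieDerivMetric g V X Y x + 2 * ricci g x (X x) (Y x)
      + (2 * lam - (p + 2 / (finrank ℝ E : ℝ))) * g.inner x (X x) (Y x)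
      + 2 * mu * (η x (X x) * η x (Y x)) = 0

end Riemannian

end KenmotsuGeometry

end

namespace KenmotsuGeometry

/-- The algebra of a Riemannian manifold: a module `𝔛` of vector fields over a ring `𝓕` of
functions, with a metric and its torsion-free metric connection. The Lie bracket is
`conn X Y - conn Y X`. -/
structure MetricConnection (𝓕 𝔛 : Type*) [CommRing 𝓕] [Algebra ℝ 𝓕] [AddCommGroup 𝔛]
    [Module 𝓕 𝔛] where
  /-- the derivative of a function along a vector field -/
  der : 𝔛 →ₗ[𝓕] Derivation ℝ 𝓕 𝓕
  /-- the covariant derivative -/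
  conn : 𝔛 →ₗ[𝓕] (𝔛 →+ 𝔛)
  /-- the metric -/
  inner : 𝔛 →ₗ[𝓕] 𝔛 →ₗ[𝓕] 𝓕
  conn_smul : ∀ X (f : 𝓕) Y, conn X (f • Y) = f • conn X Y + der X f • Y
  inner_comm : ∀ X Y, inner X Y = inner Y X
  inner_self_eq_zero : ∀ X, inner X X = 0 → X = 0
  der_inner : ∀ X Y Z, der X (inner Y Z) = inner (conn X Y) Z + inner Y (conn X Z)
  der_bracket : ∀ X Y f,
    der (conn X Y - conn Y X) f = der X (der Y f) - der Y (der X f)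
  jacobi : ∀ X Y Z,
    conn X (conn Y Z - conn Z Y) - conn (conn Y Z - conn Z Y) X =
      (conn (conn X Y - conn Y X) Z - conn Z (conn X Y - conn Y X)) +
      (conn Y (conn X Z - conn Z X) - conn (conn X Z - conn Z X) Y)

namespace MetricConnection

variable {𝓕 𝔛 : Type*} [CommRing 𝓕] [Algebra ℝ 𝓕] [AddCommGroup 𝔛] [Module 𝓕 𝔛]

theorem eq_zero_of_natCast_mul {k : ℕ} (hk : k ≠ 0) {a : 𝓕} (h : (k : 𝓕) * a = 0) : a = 0 := by
  have h1 : algebraMap ℝ 𝓕 ((k : ℝ)⁻¹) * (k : 𝓕) = 1 := by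
    rw [← map_natCast (algebraMap ℝ 𝓕) k, ← map_mul, inv_mul_cancel₀ (by exact_mod_cast hk),
      map_one]
  calc a = algebraMap ℝ 𝓕 ((k : ℝ)⁻¹) * (k : 𝓕) * a := by rw [h1, one_mul]
    _ = 0 := by rw [mul_assoc, h, mul_zero]

theorem eq_zero_of_two_mul {a : 𝓕} (h : 2 * a = 0) : a = 0 :=
  eq_zero_of_natCast_mul (k := 2) (by norm_num) (by exact_mod_cast h)

variable (A : MetricConnection 𝓕 𝔛)

theorem der_ofNat (X : 𝔛) (k : ℕ) [k.AtLeastTwo] : A.der X (ofNat(k) : 𝓕) = 0 :=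
  (A.der X).map_natCast k

theorem ext_inner {X Y : 𝔛} (h : ∀ Z, A.inner X Z = A.inner Y Z) : X = Y := by
  rw [← sub_eq_zero]
  apply A.inner_self_eq_zero
  rw [A.inner.map_sub, LinearMap.sub_apply, h, sub_self]

/-- The Lie bracket. -/
def bracket (X Y : 𝔛) : 𝔛 := A.conn X Y - A.conn Y X

/-- The curvature `R(X, Y)Z`. -/
def curv (X Y Z : 𝔛) : 𝔛 :=
  A.conn X (A.conn Y Z) - A.conn Y (A.conn X Z) - A.conn (A.bracket X Y) Z

/-- The Lie derivative of the metric along `V`. -/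
def lieInner (V X Y : 𝔛) : 𝓕 := A.inner (A.conn X V) Y + A.inner (A.conn Y V) X

theorem curv_add_left (X X' Y Z : 𝔛) : A.curv (X + X') Y Z = A.curv X Y Z + A.curv X' Y Z := by
  simp only [curv, bracket, map_add, map_sub, AddMonoidHom.add_apply, AddMonoidHom.sub_apply]
  abel

theorem curv_swap (X Y Z : 𝔛) : A.curv X Y Z = -A.curv Y X Z := by
  simp only [curv, bracket, map_sub, AddMonoidHom.sub_apply]
  abel

theorem curv_smul_left (f : 𝓕) (X Y Z : 𝔛) : A.curv (f • X) Y Z = f • A.curv X Y Z := by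
  simp only [curv, bracket, map_sub, map_smul, AddMonoidHom.sub_apply, AddMonoidHom.smul_apply,
    conn_smul, map_add, AddMonoidHom.add_apply]
  module

theorem curv_add_middle (X Y Y' Z : 𝔛) : A.curv X (Y + Y') Z = A.curv X Y Z + A.curv X Y' Z := by
  rw [curv_swap, curv_add_left, A.curv_swap X Y, A.curv_swap X Y']; abel

theorem curv_smul_middle (f : 𝓕) (X Y Z : 𝔛) : A.curv X (f • Y) Z = f • A.curv X Y Z := by
  rw [curv_swap, curv_smul_left, A.curv_swap X Y]; module

theorem curv_add_right (X Y Z Z' : 𝔛) : A.curv X Y (Z + Z') = A.curv X Y Z + A.curv X Y Z' := by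
  simp only [curv, bracket, map_add]
  abel

theorem curv_smul_right (f : 𝓕) (X Y Z : 𝔛) : A.curv X Y (f • Z) = f • A.curv X Y Z := by
  simp only [curv, bracket, conn_smul, map_add, A.der_bracket]
  module

/-- `R(·, Y)Z` as a linear map. -/
def curvLinear (Y Z : 𝔛) : 𝔛 →ₗ[𝓕] 𝔛 where
  toFun X := A.curv X Y Z
  map_add' X X' := A.curv_add_left X X' Y Z
  map_smul' f X := A.curv_smul_left f X Y Z

theorem inner_curv_skew (X Y Z W : 𝔛) : A.inner (A.curv X Y Z) W = -A.inner (A.curv X Y W) Z := by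
  have h := A.der_bracket X Y (A.inner Z W)
  simp only [A.der_inner, map_add] at h
  simp only [curv, bracket, map_sub, LinearMap.sub_apply, AddMonoidHom.sub_apply] at h ⊢
  rw [A.inner_comm (A.conn X (A.conn Y W)), A.inner_comm (A.conn Y (A.conn X W)),
    A.inner_comm (A.conn (A.conn X Y) W), A.inner_comm (A.conn (A.conn Y X) W)]
  linear_combination -h

theorem curv_bianchi (X Y Z : 𝔛) : A.curv X Y Z + A.curv Y Z X + A.curv Z X Y = 0 := by
  have h := A.jacobi X Y Z
  simp only [curv, bracket, map_sub, AddMonoidHom.sub_apply] at h ⊢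
  linear_combination (norm := abel) h

theorem inner_curv_pair (X Y Z W : 𝔛) : A.inner (A.curv X Y Z) W = A.inner (A.curv Z W X) Y := by
  have b : ∀ X Y Z W, A.inner (A.curv X Y Z) W + A.inner (A.curv Y Z X) W +
      A.inner (A.curv Z X Y) W = 0 := fun X Y Z W ↦ by
    simpa using congrArg (fun T ↦ A.inner T W) (A.curv_bianchi X Y Z)
  have s : ∀ X Y Z W, A.inner (A.curv X Y Z) W = -A.inner (A.curv Y X Z) W := fun X Y Z W ↦ by
    rw [A.curv_swap, map_neg, LinearMap.neg_apply]
  have k := A.inner_curv_skew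
  rw [← sub_eq_zero]
  apply eq_zero_of_two_mul
  linear_combination b X Y Z W + b Y Z W X - b Z W X Y - b W X Y Z
    + k Y Z W X - s Z X Y W - k X Z Y W + k X Y W Z
    - k Z W Y X - k W Y X Z + s W Y Z X
    + 2 * k X Z W Y - 2 * k Y Z X W + k W X Z Y + s Y W X Z - s Y W Z X

theorem der_bracket' (X Y : 𝔛) (f : 𝓕) :
    A.der (A.bracket X Y) f = A.der X (A.der Y f) - A.der Y (A.der X f) := A.der_bracket X Y f

theorem lieInner_eq (V X Y : 𝔛) : A.lieInner V X Y =
    A.der V (A.inner X Y) - A.inner (A.bracket V X) Y - A.inner X (A.bracket V Y) := by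
  simp only [lieInner, bracket, A.der_inner, map_sub, LinearMap.sub_apply,
    A.inner_comm X (A.conn Y V)]
  ring

/-- The commutator of the Lie derivatives along `V` and `W` is the Lie derivative along
`[V, W]`. -/
theorem lieInner_bracket (V W X Y : 𝔛) : A.lieInner (A.bracket V W) X Y =
    (A.der V (A.lieInner W X Y) - A.lieInner W (A.bracket V X) Y - A.lieInner W X (A.bracket V Y))
    - (A.der W (A.lieInner V X Y) - A.lieInner V (A.bracket W X) Y
      - A.lieInner V X (A.bracket W Y)) := by
  have j : ∀ X, A.bracket (A.bracket V W) X =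
      A.bracket V (A.bracket W X) - A.bracket W (A.bracket V X) := fun X ↦
    eq_sub_of_add_eq (A.jacobi V W X).symm
  simp only [lieInner_eq, map_sub, A.der_bracket', j, LinearMap.sub_apply]
  ring

/-- The second Bianchi identity. -/
theorem curv_bianchi_second (X Y Z T : 𝔛) :
    (A.conn X (A.curv Y Z T) - A.curv Y Z (A.conn X T) - A.curv (A.bracket X Y) Z T) +
    (A.conn Y (A.curv Z X T) - A.curv Z X (A.conn Y T) - A.curv (A.bracket Y Z) X T) +
    (A.conn Z (A.curv X Y T) - A.curv X Y (A.conn Z T) - A.curv (A.bracket Z X) Y T) = 0 := by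
  have h : A.conn (A.bracket (A.bracket X Y) Z) T + A.conn (A.bracket (A.bracket Y Z) X) T +
      A.conn (A.bracket (A.bracket Z X) Y) T = 0 := by
    have h0 : A.bracket (A.bracket X Y) Z + A.bracket (A.bracket Y Z) X +
        A.bracket (A.bracket Z X) Y = 0 := by
      have h := A.jacobi X Y Z
      simp only [bracket, map_sub, AddMonoidHom.sub_apply] at h ⊢
      linear_combination (norm := abel) -h
    rw [← AddMonoidHom.add_apply, ← AddMonoidHom.add_apply, ← map_add, ← map_add, h0, map_zero,
      AddMonoidHom.zero_apply]
  simp only [curv, map_sub] at h ⊢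
  linear_combination (norm := abel) h

/-- `P` is the gradient of `f`. -/
def IsGradient (P : 𝔛) (f : 𝓕) : Prop := ∀ X, A.inner P X = A.der X f

variable {A}

theorem IsGradient.inner_conn_comm {P : 𝔛} {f : 𝓕} (h : A.IsGradient P f) (X Y : 𝔛) :
    A.inner (A.conn X P) Y = A.inner (A.conn Y P) X := by
  have h1 := A.der_bracket X Y f
  rw [← h X, ← h Y, ← h, A.der_inner, A.der_inner] at h1
  simp only [map_sub] at h1
  linear_combination -h1

theorem IsGradient.lieInner_eq {P : 𝔛} {f : 𝓕} (h : A.IsGradient P f) (X Y : 𝔛) :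
    A.lieInner P X Y = 2 * A.inner (A.conn X P) Y := by
  rw [lieInner, h.inner_conn_comm Y X]; ring

variable (A) in
/-- A local frame `vec` and its `g`-dual `dual`, cut off by the function `cutoff`. -/
structure Frame (d : ℕ) where
  /-- the frame -/
  vec : Fin d → 𝔛
  /-- the dual frame -/
  dual : Fin d → 𝔛
  /-- the cutoff function -/
  cutoff : 𝓕
  sum_smul : ∀ X, ∑ i, A.inner X (dual i) • vec i = cutoff • X
  sum_inner : ∑ i, A.inner (vec i) (dual i) = cutoff * d

variable (A) in
/-- `t` is the trace of `T`, tested on all local frames. -/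
def IsTrace (d : ℕ) (T : 𝔛 → 𝔛) (t : 𝓕) : Prop :=
  ∀ fr : A.Frame d, ∑ i, A.inner (T (fr.vec i)) (fr.dual i) = fr.cutoff * t

variable (A) in
/-- A function that every cutoff function annihilates is zero: there are local frames around every
point. -/
def HasLocalFrames (d : ℕ) : Prop :=
  ∀ a : 𝓕, (∀ fr : A.Frame d, fr.cutoff * a = 0) → a = 0

variable {d : ℕ}

theorem IsTrace.add {T T' : 𝔛 → 𝔛} {t t' : 𝓕} (h : A.IsTrace d T t) (h' : A.IsTrace d T' t') :
    A.IsTrace d (fun X ↦ T X + T' X) (t + t') := fun fr ↦ by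
  simp only [map_add, LinearMap.add_apply, Finset.sum_add_distrib, h fr, h' fr, mul_add]

theorem IsTrace.sub {T T' : 𝔛 → 𝔛} {t t' : 𝓕} (h : A.IsTrace d T t) (h' : A.IsTrace d T' t') :
    A.IsTrace d (fun X ↦ T X - T' X) (t - t') := fun fr ↦ by
  simp only [map_sub, LinearMap.sub_apply, Finset.sum_sub_distrib, h fr, h' fr, mul_sub]

theorem IsTrace.smul {T : 𝔛 → 𝔛} {t : 𝓕} (a : 𝓕) (h : A.IsTrace d T t) :
    A.IsTrace d (fun X ↦ a • T X) (a * t) := fun fr ↦ by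
  simp only [map_smul, LinearMap.smul_apply, smul_eq_mul, ← Finset.mul_sum, h fr]
  ring

theorem isTrace_id : A.IsTrace d (fun X ↦ X) d := fun fr ↦ fr.sum_inner

theorem isTrace_smul_const (l : 𝔛 →ₗ[𝓕] 𝓕) (Z : 𝔛) :
    A.IsTrace d (fun X ↦ l X • Z) (l Z) := fun fr ↦ by
  rw [← smul_eq_mul, ← map_smul, ← fr.sum_smul Z, map_sum]
  simp only [map_smul, LinearMap.smul_apply, smul_eq_mul, mul_comm]

variable (A) in
/-- The differential of `f`, as a linear map. -/
def differential (f : 𝓕) : 𝔛 →ₗ[𝓕] 𝓕 where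
  toFun X := A.der X f
  map_add' X Y := by rw [map_add, Derivation.add_apply]
  map_smul' a X := by rw [map_smul, Derivation.smul_apply, RingHom.id_apply]

theorem isTrace_der_smul (f : 𝓕) (Z : 𝔛) : A.IsTrace d (fun X ↦ A.der X f • Z) (A.der Z f) :=
  isTrace_smul_const (A.differential f) Z

theorem isTrace_inner_smul (Y Z : 𝔛) : A.IsTrace d (fun X ↦ A.inner X Y • Z) (A.inner Z Y) :=
  isTrace_smul_const (A.inner.flip Y) Z

theorem IsTrace.unique (hloc : A.HasLocalFrames d) {T : 𝔛 → 𝔛} {t t' : 𝓕} (h : A.IsTrace d T t)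
    (h' : A.IsTrace d T t') : t = t' := by
  rw [← sub_eq_zero]
  refine hloc _ fun fr ↦ ?_
  rw [mul_sub, ← h fr, ← h' fr, sub_self]

/-- The trace commutes with the covariant derivative. -/
theorem IsTrace.der_eq [IsReduced 𝓕] (hloc : A.HasLocalFrames d) (T : 𝔛 →ₗ[𝓕] 𝔛) {t s : 𝓕} (Q : 𝔛)
    (h : A.IsTrace d T t) (h' : A.IsTrace d (fun X ↦ A.conn Q (T X) - T (A.conn Q X)) s) :
    A.der Q t = s := by
  rw [← sub_eq_zero]
  refine hloc _ fun fr ↦ ?_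
  have hder : ∀ X, ∑ i, (A.inner X (A.conn Q (fr.dual i)) • fr.vec i
      + A.inner X (fr.dual i) • A.conn Q (fr.vec i)) = A.der Q fr.cutoff • X := fun X ↦ by
    have h1 := congrArg (A.conn Q) (fr.sum_smul X)
    have h2 := fr.sum_smul (A.conn Q X)
    simp only [map_sum, A.conn_smul, A.der_inner, add_smul, Finset.sum_add_distrib] at h1 h2 ⊢
    linear_combination (norm := module) h1 - h2
  have hcontract : ∀ X Y, ∑ j, A.inner X (fr.dual j) * A.inner (fr.vec j) Y =
      fr.cutoff * A.inner X Y := fun X Y ↦ by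
    simpa using congrArg (fun W ↦ A.inner W Y) (fr.sum_smul X)
  have key : fr.cutoff * ∑ i, (A.inner (T (fr.vec i)) (A.conn Q (fr.dual i))
      + A.inner (T (A.conn Q (fr.vec i))) (fr.dual i)) = A.der Q fr.cutoff * (fr.cutoff * t) := by
    rw [← h fr, Finset.mul_sum, Finset.mul_sum]
    calc _ = ∑ i, ∑ j, (A.inner (T (fr.vec i)) (fr.dual j) *
            A.inner (fr.vec j) (A.conn Q (fr.dual i))
          + A.inner (T (A.conn Q (fr.vec i))) (fr.dual j) * A.inner (fr.vec j) (fr.dual i)) := by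
          refine Finset.sum_congr rfl fun i _ ↦ ?_
          rw [mul_add, ← hcontract, ← hcontract, Finset.sum_add_distrib]
      _ = _ := by
          rw [Finset.sum_comm]
          refine Finset.sum_congr rfl fun j _ ↦ ?_
          have := congrArg (fun W ↦ A.inner (T W) (fr.dual j)) (hder (fr.vec j))
          simp only [map_sum, map_add, map_smul, LinearMap.sum_apply, LinearMap.add_apply,
            LinearMap.smul_apply, smul_eq_mul] at this
          rw [← this]
          exact Finset.sum_congr rfl fun i _ ↦ by ring
  have h1 := congrArg (A.der Q) (h fr)
  have h2 := h' fr
  simp only [map_sum, map_sub, A.der_inner, LinearMap.sub_apply, Finset.sum_add_distrib,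
    Finset.sum_sub_distrib, Derivation.leibniz, smul_eq_mul] at h1 h2 key
  apply IsReduced.eq_zero
  refine ⟨2, ?_⟩
  linear_combination (A.der Q t - s) * key
    - (A.der Q t - s) * fr.cutoff * h1 + (A.der Q t - s) * fr.cutoff * h2

end MetricConnection

end KenmotsuGeometry

namespace KenmotsuGeometry

namespace MetricConnection

variable {𝓕 𝔛 : Type*} [CommRing 𝓕] [Algebra ℝ 𝓕] [AddCommGroup 𝔛] [Module 𝓕 𝔛]

/-- `ξ` is a unit vector field with `∇_X ξ = X - g(X, ξ)ξ`, as on a Kenmotsu manifold. -/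
structure IsKenmotsuField (A : MetricConnection 𝓕 𝔛) (ξ : 𝔛) : Prop where
  inner_self : A.inner ξ ξ = 1
  conn_eq : ∀ X, A.conn X ξ = X - A.inner X ξ • ξ

variable {A : MetricConnection 𝓕 𝔛} {ξ : 𝔛}

namespace IsKenmotsuField

theorem der_inner (h : A.IsKenmotsuField ξ) (X Y : 𝔛) : A.der X (A.inner Y ξ) =
    A.inner (A.conn X Y) ξ + A.inner X Y - A.inner X ξ * A.inner Y ξ := by
  rw [A.der_inner, h.conn_eq, map_sub, map_smul, smul_eq_mul, A.inner_comm Y X]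
  ring

theorem curv_field (h : A.IsKenmotsuField ξ) (X Y : 𝔛) :
    A.curv X Y ξ = A.inner X ξ • Y - A.inner Y ξ • X := by
  simp only [curv, bracket, h.conn_eq, map_sub, A.conn_smul, h.der_inner, AddMonoidHom.sub_apply,
    A.inner_comm Y X]
  module

theorem curv_field_middle (h : A.IsKenmotsuField ξ) (Y Z : 𝔛) :
    A.curv Y ξ Z = A.inner Y Z • ξ - A.inner Z ξ • Y := by
  refine A.ext_inner fun W ↦ ?_
  rw [A.inner_curv_pair, A.inner_curv_skew, h.curv_field]
  simp only [map_sub, map_smul, LinearMap.sub_apply, LinearMap.smul_apply, smul_eq_mul,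
    A.inner_comm W Y, A.inner_comm ξ W, A.inner_comm Z Y]
  ring

theorem curv_field_left (h : A.IsKenmotsuField ξ) (Y Z : 𝔛) :
    A.curv ξ Y Z = A.inner Z ξ • Y - A.inner Y Z • ξ := by
  rw [A.curv_swap, h.curv_field_middle, neg_sub]

theorem curv_der (h : A.IsKenmotsuField ξ) (X Y Z : 𝔛) :
    A.conn ξ (A.curv X Y Z) - A.curv (A.conn ξ X) Y Z = A.curv X (A.conn ξ Y) Z +
      A.curv X Y (A.conn ξ Z) - (2 : 𝓕) • A.curv X Y Z + A.inner X ξ • A.curv ξ Y Z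
      + A.inner Y ξ • A.curv X ξ Z - ((2 * A.inner Y Z) • X - A.inner X Z • ((2 : 𝓕) • Y) -
        A.inner X ξ • A.inner Y Z • ξ + A.inner X Z • A.inner Y ξ • ξ +
        A.inner X ξ • A.inner Z ξ • Y - (A.inner Y ξ * A.inner Z ξ) • X) := by
  have hb := A.curv_bianchi_second ξ X Y Z
  have e : ∀ X, A.bracket ξ X = A.conn ξ X + (-1 : 𝓕) • X + A.inner X ξ • ξ := fun X ↦ by
    rw [bracket, h.conn_eq]; module
  have e' : A.bracket Y ξ = (-1 : 𝓕) • A.conn ξ Y + Y + (-A.inner Y ξ) • ξ := by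
    rw [bracket, h.conn_eq]; module
  rw [e, e', A.curv_swap Y ξ] at hb
  simp only [A.curv_add_left, A.curv_smul_left, A.curv_swap (A.conn ξ Y) X, A.curv_swap Y X] at hb
  simp only [h.curv_field_left, h.curv_field_middle, map_sub, map_neg, A.conn_smul, h.conn_eq,
    h.der_inner, A.der_inner] at hb ⊢
  simp only [bracket, map_sub, LinearMap.sub_apply] at hb
  linear_combination (norm := module) hb

end IsKenmotsuField

/-- `A` has dimension `2 * n + 1`, and its Ricci tensor is `α g + β η ⊗ η`, where `η = g(·, ξ)`. -/
structure IsEtaEinsteinField (A : MetricConnection 𝓕 𝔛) (ξ : 𝔛) (n : ℕ) (α β : 𝓕) : Prop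
    extends A.IsKenmotsuField ξ where
  ne_zero : n ≠ 0
  hasLocalFrames : A.HasLocalFrames (2 * n + 1)
  isTrace_curv : ∀ Y Z, A.IsTrace (2 * n + 1) (fun X ↦ A.curv X Y Z)
    (α * A.inner Y Z + β * (A.inner Y ξ * A.inner Z ξ))

namespace IsEtaEinsteinField

variable {n : ℕ} {α β : 𝓕}

theorem eq_sub (h : A.IsEtaEinsteinField ξ n α β) : α = -2 * n - β := by
  have h1 := (h.isTrace_curv ξ ξ).unique h.hasLocalFrames (t' := 1 - 1 * ((2 * n + 1 : ℕ) : 𝓕)) (by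
    simp only [h.curv_field, h.inner_self]
    exact .sub (by simpa only [h.inner_self] using
      isTrace_inner_smul (A := A) (d := 2 * n + 1) ξ ξ) (isTrace_id.smul 1))
  rw [h.inner_self] at h1
  push_cast at h1
  linear_combination h1

theorem eq_zero_of_forall_smul (h : A.IsEtaEinsteinField ξ n α β) {a : 𝓕}
    (ha : ∀ X, a • (X - A.inner X ξ • ξ) = 0) : a = 0 := by
  have h1 : A.IsTrace (2 * n + 1) (fun X ↦ a • (X - A.inner X ξ • ξ))
      (a * (((2 * n + 1 : ℕ) : 𝓕) - A.inner ξ ξ)) :=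
    (isTrace_id.sub (isTrace_inner_smul ξ ξ)).smul a
  have h2 : A.IsTrace (2 * n + 1) (fun X ↦ a • (X - A.inner X ξ • ξ)) 0 := fun fr ↦ by simp [ha]
  have h3 := h1.unique h.hasLocalFrames h2
  rw [h.inner_self] at h3
  push_cast at h3
  refine eq_zero_of_natCast_mul (k := 2 * n) (mul_ne_zero two_ne_zero h.ne_zero) ?_
  push_cast
  linear_combination h3

theorem der_eq [IsReduced 𝓕] (h : A.IsEtaEinsteinField ξ n α β) : A.der ξ β = -2 * β := by
  have hS := h.isTrace_curv
  have key : ∀ Y Z, _ := fun Y Z ↦ (hS Y Z).der_eq h.hasLocalFrames (A.curvLinear Y Z) ξ (by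
    show A.IsTrace _ (fun X ↦ A.conn ξ (A.curv X Y Z) - A.curv (A.conn ξ X) Y Z) _
    simp only [h.curv_der]
    exact (((((hS (A.conn ξ Y) Z).add (hS Y (A.conn ξ Z))).sub ((hS Y Z).smul 2)).add
      (isTrace_inner_smul ξ _)).add ((hS ξ Z).smul _)).sub
      (((((isTrace_id.smul _).sub (isTrace_inner_smul Z _)).sub (isTrace_inner_smul ξ _)).add
      (isTrace_inner_smul Z _)).add (isTrace_inner_smul ξ _) |>.sub (isTrace_id.smul _)))
  rw [← sub_eq_zero]
  refine h.eq_zero_of_forall_smul fun Y ↦ A.ext_inner fun Z ↦ ?_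
  have k := key Y Z
  simp only [h.eq_sub, map_add, map_sub, Derivation.leibniz, h.der_inner, A.der_inner, map_smul,
    LinearMap.sub_apply, LinearMap.smul_apply, smul_eq_mul, h.curv_field_left, h.inner_self,
    Derivation.map_natCast, map_neg, A.inner_comm ξ, A.der_ofNat, map_zero,
    LinearMap.zero_apply] at k ⊢
  push_cast at k
  linear_combination -k

end IsEtaEinsteinField

end MetricConnection

end KenmotsuGeometry

namespace KenmotsuGeometry

namespace MetricConnection

variable {𝓕 𝔛 : Type*} [CommRing 𝓕] [Algebra ℝ 𝓕] [AddCommGroup 𝔛] [Module 𝓕 𝔛]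
  {A : MetricConnection 𝓕 𝔛} {ξ : 𝔛} {n : ℕ} {α β : 𝓕}

theorem IsKenmotsuField.conn_self (h : A.IsKenmotsuField ξ) : A.conn ξ ξ = 0 := by
  rw [h.conn_eq, h.inner_self, one_smul, sub_self]

theorem IsKenmotsuField.lieInner_self (h : A.IsKenmotsuField ξ) (X Y : 𝔛) :
    A.lieInner ξ X Y = 2 * (A.inner X Y - A.inner X ξ * A.inner Y ξ) := by
  simp only [lieInner, h.conn_eq, map_sub, map_smul, LinearMap.sub_apply, LinearMap.smul_apply,
    smul_eq_mul, A.inner_comm ξ, A.inner_comm Y X]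
  ring

theorem IsKenmotsuField.curv_of_conn_eq (h : A.IsKenmotsuField ξ) {P Q : 𝔛} {f b τ ρ σ : 𝓕}
    (hP : ∀ X, A.conn X P =
      τ • X - (ρ * A.inner X ξ) • ξ - A.inner X ξ • P - A.der X f • ξ - (4 * A.der X b) • Q)
    (hQ : ∀ X, A.conn X Q = σ • X - (σ * A.inner X ξ) • ξ - A.inner X ξ • Q - A.der X b • ξ)
    (X Y : 𝔛) :
    A.curv X Y P = A.der X τ • Y - A.der Y τ • X - A.der X ρ • A.inner Y ξ • ξ
      + A.inner X ξ • A.der Y ρ • ξ - ((ρ + τ) * A.inner Y ξ) • X + A.inner X ξ • (ρ + τ) • Y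
      - A.der Y f • X + A.der X f • Y - (4 * σ * A.der Y b) • X + A.der X b • (4 * σ) • Y
      + A.inner X ξ • (4 * σ * A.der Y b) • ξ - A.der X b • (4 * σ * A.inner Y ξ) • ξ := by
  simp only [curv, hP, map_sub, A.conn_smul, h.conn_eq, h.der_inner, Derivation.leibniz,
    smul_eq_mul, A.der_ofNat, hQ, A.der_bracket', mul_zero, add_zero]
  simp only [bracket, A.inner_comm Y X, map_sub, LinearMap.sub_apply]
  module

/-- `V` satisfies the soliton equation `L_V g + 2 S + 2 l g + 2 μ η ⊗ η = 0` with constants `l`,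
`μ`. -/
structure IsSolitonField (A : MetricConnection 𝓕 𝔛) (ξ : 𝔛) (n : ℕ) (α β l μ : 𝓕) (V : 𝔛) : Prop
    extends A.IsEtaEinsteinField ξ n α β where
  der_left : ∀ X, A.der X l = 0
  der_right : ∀ X, A.der X μ = 0
  lieInner_eq : ∀ X Y, A.lieInner V X Y =
    -2 * (α + l) * A.inner X Y - 2 * (β + μ) * (A.inner X ξ * A.inner Y ξ)

namespace IsSolitonField

variable {l μ : 𝓕} {V : 𝔛}

variable (A ξ n l μ V) in
/-- The gradient of `g(V, ξ)`. -/
def grad : 𝔛 := (2 * (2 * n - l - μ)) • ξ + V - A.inner V ξ • ξ - A.conn ξ V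

theorem inner_conn_left (h : A.IsSolitonField ξ n α β l μ V) (X : 𝔛) :
    A.inner (A.conn ξ V) X =
      2 * (2 * n - l - μ) * A.inner X ξ - A.inner (A.conn X V) ξ := by
  have := h.lieInner_eq ξ X
  rw [lieInner, h.inner_self, A.inner_comm ξ X, h.eq_sub] at this
  linear_combination this

theorem der_field (h : A.IsSolitonField ξ n α β l μ V) :
    A.der ξ (A.inner V ξ) = 2 * n - l - μ := by
  have := h.inner_conn_left ξ
  rw [h.inner_self] at this
  rw [A.der_inner, h.conn_self, map_zero, ← sub_eq_zero]
  exact eq_zero_of_two_mul (by linear_combination this)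

theorem isGradient_grad (h : A.IsSolitonField ξ n α β l μ V) :
    A.IsGradient (grad A ξ n l μ V) (A.inner V ξ) := fun X ↦ by
  simp only [grad, map_add, map_sub, map_smul, LinearMap.add_apply, LinearMap.sub_apply,
    LinearMap.smul_apply, smul_eq_mul, h.inner_conn_left, A.inner_comm ξ X, h.der_inner,
    A.inner_comm X V]
  ring

theorem inner_grad_field (h : A.IsSolitonField ξ n α β l μ V) :
    A.inner (grad A ξ n l μ V) ξ = 2 * n - l - μ := by
  rw [h.isGradient_grad, h.der_field]

theorem bracket_field (h : A.IsSolitonField ξ n α β l μ V) :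
    A.bracket ξ V = (2 * (2 * n - l - μ)) • ξ - grad A ξ n l μ V := by
  rw [bracket, h.conn_eq, grad]
  module

theorem conn_grad_aux [IsReduced 𝓕] (h : A.IsSolitonField ξ n α β l μ V) (X : 𝔛) :
    A.conn X (grad A ξ n l μ V) = (2 * (2 * n - l - μ) + 2 * β) • X - (2 * β * A.inner X ξ) • ξ
      - A.inner X ξ • grad A ξ n l μ V - A.der X (A.inner V ξ) • ξ := by
  refine A.ext_inner fun Y ↦ ?_
  have hP := h.isGradient_grad
  have e : ∀ X Y, A.lieInner V X Y =
      (2 * β - 2 * (l - 2 * n)) * A.inner X Y - 2 * (β + μ) * (A.inner X ξ * A.inner Y ξ) :=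
    fun X Y ↦ by rw [h.lieInner_eq, h.eq_sub]; ring
  have h1 := A.lieInner_bracket ξ V X Y
  have h2 := hP.lieInner_eq X Y
  have h3 := h.lieInner_self X Y
  have h4 : A.lieInner (A.bracket ξ V) X Y =
      2 * (2 * n - l - μ) * A.lieInner ξ X Y - A.lieInner (grad A ξ n l μ V) X Y := by
    have hc : ∀ X, A.der X (2 * (2 * (n : 𝓕) - l - μ)) = 0 := fun X ↦ by
      simp [h.der_left, h.der_right, A.der_ofNat]
    rw [h.bracket_field]
    simp only [lieInner, map_sub, A.conn_smul, hc, zero_smul, add_zero, map_smul,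
      LinearMap.sub_apply, LinearMap.smul_apply, smul_eq_mul]
    ring
  rw [h4, h2] at h1
  have hV : ∀ X, A.der V (A.inner X ξ) = A.der X (A.inner V ξ) + A.inner (A.bracket V X) ξ := fun X ↦ by
    rw [h.der_inner, h.der_inner, bracket, map_sub, LinearMap.sub_apply, A.inner_comm V X]; ring
  rw [← sub_eq_zero]
  apply eq_zero_of_two_mul
  simp only [e, h.lieInner_self, map_sub, map_add, Derivation.leibniz, smul_eq_mul, hV,
    A.der_ofNat, h.der_eq, h.der_left, h.der_right, Derivation.map_natCast, h.der_inner] at h1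
  have k1 := A.lieInner_eq V X Y
  have k2 := A.lieInner_eq ξ X Y
  have f1 : ∀ X, A.inner (A.bracket ξ X) ξ = A.inner (A.conn ξ X) ξ := fun X ↦ by
    rw [bracket, h.conn_eq]
    simp [h.inner_self]
  rw [e] at k1
  rw [h.lieInner_self] at k2
  simp only [map_sub, map_smul, LinearMap.sub_apply, LinearMap.smul_apply, smul_eq_mul, hP Y,
    A.inner_comm ξ, f1, h.inner_self] at h1 k1 k2 ⊢
  linear_combination -h1 + (2 * β - 2 * (l - 2 * n)) * k2 - 2 * k1
    + 2 * A.inner X ξ * h.der_inner Y V + 2 * A.inner Y ξ * h.der_inner X V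

theorem isTrace_curv_grad_aux [IsReduced 𝓕] (h : A.IsSolitonField ξ n α β l μ V) (Y : 𝔛) :
    2 * (2 * n - 1) * A.der Y β = β * A.der Y (A.inner V ξ)
      - (2 * n - l - μ) * β * A.inner Y ξ - 4 * (2 * n - 1) * β * A.inner Y ξ
      - 4 * n * (2 * n - l - μ) * A.inner Y ξ := by
  have hc : ∀ X, A.der X (2 * (2 * (n : 𝓕) - l - μ) + 2 * β) = A.der X (2 * β) := fun X ↦ by
    simp [h.der_left, h.der_right, A.der_ofNat]
  have key := (h.isTrace_curv Y (grad A ξ n l μ V)).unique h.hasLocalFrames (by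
    simp only [h.curv_of_conn_eq (Q := 0) (b := 0) (σ := 0)
      (fun X ↦ by rw [h.conn_grad_aux, smul_zero, sub_zero]) (fun X ↦ by simp)]
    exact (((((((((((isTrace_der_smul _ _).sub (isTrace_id.smul _)).sub
      (isTrace_der_smul _ _)).add (isTrace_inner_smul _ _)).sub (isTrace_id.smul _)).add
      (isTrace_inner_smul _ _)).sub (isTrace_id.smul _)).add (isTrace_der_smul _ _)).sub
      (isTrace_id.smul _)).add (isTrace_der_smul _ _)).add (isTrace_inner_smul _ _)).sub
      (isTrace_der_smul _ _))
  rw [A.inner_comm Y (grad A ξ n l μ V), h.isGradient_grad, h.inner_grad_field, h.eq_sub] at key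
  simp only [hc, map_smul, Derivation.smul_apply, LinearMap.smul_apply, smul_eq_mul, h.inner_self,
    map_zero, Derivation.leibniz, A.der_ofNat, h.der_eq] at key
  push_cast at key
  rw [← sub_eq_zero]
  linear_combination key

theorem const_eq_zero [IsReduced 𝓕] (h : A.IsSolitonField ξ n α β l μ V) :
    2 * n - l - μ = 0 := by
  have key := h.isTrace_curv_grad_aux ξ
  rw [h.der_eq, h.der_field, h.inner_self] at key
  refine eq_zero_of_natCast_mul (k := 4 * n) (mul_ne_zero four_ne_zero h.ne_zero) ?_
  push_cast
  linear_combination key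

theorem der_beta [IsReduced 𝓕] (h : A.IsSolitonField ξ n α β l μ V) (Y : 𝔛) :
    2 * (2 * n - 1) * A.der Y β =
      β * (A.der Y (A.inner V ξ) - 4 * (2 * n - 1) * A.inner Y ξ) := by
  rw [h.isTrace_curv_grad_aux, h.const_eq_zero]; ring

theorem conn_grad [IsReduced 𝓕] (h : A.IsSolitonField ξ n α β l μ V) (X : 𝔛) :
    A.conn X (grad A ξ n l μ V) = (2 * β) • X - (2 * β * A.inner X ξ) • ξ
      - A.inner X ξ • grad A ξ n l μ V - A.der X (A.inner V ξ) • ξ := by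
  rw [h.conn_grad_aux, h.const_eq_zero, mul_zero, zero_add]

end IsSolitonField

end MetricConnection

end KenmotsuGeometry

namespace KenmotsuGeometry

namespace MetricConnection

variable {𝓕 𝔛 : Type*} [CommRing 𝓕] [Algebra ℝ 𝓕] [AddCommGroup 𝔛] [Module 𝓕 𝔛]
  {A : MetricConnection 𝓕 𝔛} {ξ : 𝔛} {n : ℕ} {α β : 𝓕}

/-- The transverse part `W` of a soliton vector field: it is orthogonal to `ξ`, conformal
transversally to `ξ` with factor `-4 b`, and the gradient `P` of `b` is determined by `β`. -/
structure IsTransverseSoliton (A : MetricConnection 𝓕 𝔛) (ξ : 𝔛) (n : ℕ) (α β b : 𝓕) (P W : 𝔛) :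
    Prop extends A.IsEtaEinsteinField ξ n α β where
  isGradient : A.IsGradient P b
  der_field : A.der ξ b = 0
  conn_grad : ∀ X, A.conn X P =
    (2 * β) • X - (2 * β * A.inner X ξ) • ξ - A.inner X ξ • P - A.der X b • ξ
  der_beta : ∀ X, 2 * (2 * n - 1) * A.der X β =
    β * (A.der X b - 4 * (2 * n - 1) * A.inner X ξ)
  inner_field : A.inner W ξ = 0
  lieInner_eq : ∀ X Y,
    A.lieInner W X Y = -4 * b * (A.inner X Y - A.inner X ξ * A.inner Y ξ)

theorem IsSolitonField.isTransverseSoliton [IsReduced 𝓕] {l μ : 𝓕} {V : 𝔛}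
    (h : A.IsSolitonField ξ n α β l μ V) :
    A.IsTransverseSoliton ξ n α β (A.inner V ξ + l - 2 * n) (grad A ξ n l μ V)
      ((2 : 𝓕) • V - grad A ξ n l μ V - (2 * A.inner V ξ) • ξ) := by
  have hb : ∀ X, A.der X (A.inner V ξ + l - 2 * n) = A.der X (A.inner V ξ) := fun X ↦ by
    simp [h.der_left, A.der_ofNat]
  have hc := h.const_eq_zero
  refine
    { h.toIsEtaEinsteinField with
      isGradient := fun X ↦ by rw [hb]; exact h.isGradient_grad X
      der_field := by rw [hb, h.der_field, hc]
      conn_grad := fun X ↦ by rw [hb]; exact h.conn_grad X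
      der_beta := fun X ↦ by rw [hb]; exact h.der_beta X
      inner_field := by
        simp [h.inner_grad_field, hc, h.inner_self]
      lieInner_eq := fun X Y ↦ ?_ }
  have hP := h.isGradient_grad.lieInner_eq X Y
  have h1 := h.lieInner_eq X Y
  have h2 := h.lieInner_self X Y
  rw [h.conn_grad] at hP
  rw [h.eq_sub] at h1
  have hPY := h.isGradient_grad Y
  simp only [lieInner, map_sub, map_smul, A.conn_smul, map_add, Derivation.leibniz, A.der_ofNat,
    smul_eq_mul, LinearMap.add_apply, LinearMap.sub_apply, LinearMap.smul_apply,
    A.inner_comm ξ, zero_mul, mul_zero, add_zero] at h1 h2 hP ⊢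
  rw [hPY] at hP
  linear_combination 2 * h1 - hP - 2 * A.inner V ξ * h2 + 4 * A.inner X ξ * A.inner Y ξ * hc

namespace IsTransverseSoliton

variable {b : 𝓕} {P W : 𝔛}

variable (A b P W) in
/-- The gradient of `W b`. -/
def gradDer : 𝔛 := A.bracket W P - (4 * b) • P

theorem inner_grad_field (h : A.IsTransverseSoliton ξ n α β b P W) : A.inner P ξ = 0 := by
  rw [h.isGradient, h.der_field]

theorem isGradient_gradDer (h : A.IsTransverseSoliton ξ n α β b P W) :
    A.IsGradient (gradDer A b P W) (A.der W b) := fun X ↦ by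
  have h1 := A.lieInner_eq W P X
  rw [h.lieInner_eq, h.isGradient X, h.isGradient (A.bracket W X), h.inner_grad_field,
    A.der_bracket'] at h1
  simp only [gradDer, map_sub, map_smul, LinearMap.sub_apply, LinearMap.smul_apply, smul_eq_mul,
    h.isGradient X]
  linear_combination h1

theorem der_inner_field {Z : 𝔛} (h : A.IsKenmotsuField ξ) (hZ : A.inner Z ξ = 0) (X : 𝔛) :
    A.der Z (A.inner X ξ) = A.inner (A.bracket Z X) ξ := by
  have := h.der_inner X Z
  rw [hZ, map_zero] at this
  rw [h.der_inner, hZ, bracket, map_sub, LinearMap.sub_apply, A.inner_comm Z X]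
  linear_combination -this

theorem lieInner_grad (h : A.IsTransverseSoliton ξ n α β b P W) (X Y : 𝔛) :
    A.lieInner P X Y = 4 * β * (A.inner X Y - A.inner X ξ * A.inner Y ξ)
      - 2 * A.inner X ξ * A.der Y b - 2 * A.der X b * A.inner Y ξ := by
  rw [h.isGradient.lieInner_eq, h.conn_grad]
  simp only [map_sub, map_smul, LinearMap.sub_apply, LinearMap.smul_apply, smul_eq_mul,
    h.isGradient Y, A.inner_comm ξ]
  ring

theorem conn_gradDer (h : A.IsTransverseSoliton ξ n α β b P W) {k : 𝓕} (hk : (2 * n - 1) * k = 1)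
    (X : 𝔛) : A.conn X (gradDer A b P W) =
      (k * β * A.der W b - 8 * β * b + 2 * A.inner P P) • X
      - ((k * β * A.der W b - 8 * β * b + 2 * A.inner P P) * A.inner X ξ) • ξ
      - A.inner X ξ • gradDer A b P W - A.der X (A.der W b) • ξ - (4 * A.der X b) • P := by
  refine A.ext_inner fun Y ↦ ?_
  have hU := h.isGradient_gradDer
  have hWβ : 2 * A.der W β = k * β * A.der W b := by
    have := h.der_beta W
    rw [h.inner_field] at this
    linear_combination k * this - 2 * A.der W β * hk
  have hPb : A.der P b = A.inner P P := (h.isGradient P).symm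
  have h1 := A.lieInner_bracket W P X Y
  have h2 : A.lieInner (A.bracket W P) X Y = A.lieInner (gradDer A b P W) X Y
      + 4 * b * A.lieInner P X Y + 8 * A.der X b * A.der Y b := by
    have : A.bracket W P = gradDer A b P W + (4 * b) • P := by rw [gradDer]; abel
    rw [this]
    simp only [lieInner, map_add, A.conn_smul, Derivation.leibniz, A.der_ofNat, smul_eq_mul,
      map_smul, LinearMap.add_apply, LinearMap.smul_apply, h.isGradient X, h.isGradient Y]
    ring
  have hWd : ∀ X, A.der W (A.der X b) = A.der X (A.der W b) + A.der (A.bracket W X) b :=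
    fun X ↦ by rw [A.der_bracket']; ring
  have k1 := A.lieInner_eq W X Y
  have k2 := A.lieInner_eq P X Y
  rw [h2, hU.lieInner_eq] at h1
  rw [← sub_eq_zero]
  apply eq_zero_of_two_mul
  simp only [h.lieInner_eq, h.lieInner_grad, map_sub, Derivation.leibniz, smul_eq_mul,
    A.der_ofNat, der_inner_field h.toIsKenmotsuField h.inner_field,
    der_inner_field h.toIsKenmotsuField h.inner_grad_field, hWd, hPb, map_neg] at h1 k1 k2
  simp only [map_sub, map_smul, LinearMap.sub_apply, LinearMap.smul_apply, smul_eq_mul,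
    h.isGradient Y, hU Y, A.inner_comm ξ]
  linear_combination h1 + 2 * (A.inner X Y - A.inner X ξ * A.inner Y ξ) * hWβ
    - 4 * β * k1 - 4 * b * k2

theorem der_field_der (h : A.IsTransverseSoliton ξ n α β b P W) : A.der ξ (A.der W b) = 0 := by
  have h1 := der_inner_field h.toIsKenmotsuField h.inner_field P
  rw [h.inner_grad_field, map_zero] at h1
  rw [← h.isGradient_gradDer, gradDer, map_sub, map_smul, LinearMap.sub_apply,
    LinearMap.smul_apply, h.inner_grad_field, ← h1, smul_zero, sub_zero]

theorem exists_inv (n : ℕ) (hn : n ≠ 0) : ∃ k : ℝ, (2 * n - 1 : 𝓕) * algebraMap ℝ 𝓕 k = 1 := by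
  refine ⟨(2 * n - 1)⁻¹, ?_⟩
  have h1 : (2 * n - 1 : 𝓕) = algebraMap ℝ 𝓕 (2 * n - 1) := by
    rw [map_sub, map_mul, map_natCast, map_one, map_ofNat]
  have h2 : (1 : ℝ) ≤ n := by exact_mod_cast Nat.one_le_iff_ne_zero.2 hn
  rw [h1, ← map_mul, mul_inv_cancel₀ (by linarith), map_one]

theorem mul_der_eq_zero [IsReduced 𝓕] (h : A.IsTransverseSoliton ξ n α β b P W) (Y : 𝔛) :
    β * (A.der W b - 8 * (2 * n - 1) * b + 16 * (2 * n - 1) ^ 2) * A.der Y b = 0 := by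
  obtain ⟨k, hk⟩ := exists_inv (𝓕 := 𝓕) n h.ne_zero
  have key : ∀ Y, _ := fun Y ↦
    (h.isTrace_curv Y (gradDer A b P W)).unique h.hasLocalFrames (by
    simp only [h.curv_of_conn_eq (h.conn_gradDer hk) h.conn_grad]
    exact (((((((((((isTrace_der_smul _ _).sub (isTrace_id.smul _)).sub
      (isTrace_der_smul _ _)).add (isTrace_inner_smul _ _)).sub (isTrace_id.smul _)).add
      (isTrace_inner_smul _ _)).sub (isTrace_id.smul _)).add (isTrace_der_smul _ _)).sub
      (isTrace_id.smul _)).add (isTrace_der_smul _ _)).add (isTrace_inner_smul _ _)).sub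
      (isTrace_der_smul _ _))
  have hPP : ∀ Y, A.der Y (A.inner P P) = 4 * β * A.der Y b - 2 * A.inner Y ξ * A.inner P P :=
    fun Y ↦ by
      rw [A.der_inner, A.inner_comm P, h.conn_grad]
      simp only [map_sub, map_smul, LinearMap.sub_apply, LinearMap.smul_apply, smul_eq_mul,
        A.inner_comm ξ P, h.inner_grad_field, A.inner_comm Y P, h.isGradient Y]
      ring
  have k1 := key Y
  have k2 := key ξ
  simp only [A.inner_comm _ (gradDer A b P W), h.isGradient_gradDer _, h.eq_sub, map_smul,
    Derivation.smul_apply, LinearMap.smul_apply, smul_eq_mul, h.inner_self, h.der_field_der,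
    h.der_field, map_add, map_sub, Derivation.leibniz, A.der_ofNat, hPP, h.der_eq,
    Derivation.map_algebraMap] at k1 k2
  push_cast at k1 k2
  have hβ := h.der_beta Y
  linear_combination 2 * (2 * n - 1) * (k1 - A.inner Y ξ * k2)
    - (A.der W b - 8 * (2 * n - 1) * b) * hβ
    - 2 * (2 * n - 1) * (A.der W b * A.der Y β + β * A.der Y (A.der W b)
      + 2 * β * A.der W b * A.inner Y ξ) * hk

theorem eq_zero_of_smul_grad (h : A.IsTransverseSoliton ξ n α β b P W) {s : 𝓕} (hs : s • P = 0) :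
    s ^ 2 * β = 0 := by
  have hd : ∀ X, s * A.der X b = 0 := fun X ↦ by
    rw [← h.isGradient, ← smul_eq_mul, ← LinearMap.smul_apply, ← map_smul, hs, map_zero,
      LinearMap.zero_apply]
  refine eq_zero_of_two_mul (h.eq_zero_of_forall_smul fun X ↦ ?_)
  have h1 : s • A.conn X P + A.der X s • P = 0 := by rw [← A.conn_smul, hs, map_zero]
  rw [h.conn_grad] at h1
  linear_combination (norm := module) s • h1 + (s * A.inner X ξ - A.der X s) • hs
    + s • congrArg (· • ξ) (hd X)

theorem beta_mul_eq_zero [IsReduced 𝓕] (h : A.IsTransverseSoliton ξ n α β b P W) :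
    β * (A.der W b - 8 * (2 * n - 1) * b + 16 * (2 * n - 1) ^ 2) = 0 := by
  have h1 := h.eq_zero_of_smul_grad (A.ext_inner fun X ↦ by
    rw [map_smul, LinearMap.smul_apply, smul_eq_mul, h.isGradient, h.mul_der_eq_zero, map_zero,
      LinearMap.zero_apply])
  exact IsReduced.eq_zero _ ⟨3, by
    linear_combination (A.der W b - 8 * (2 * n - 1) * b + 16 * (2 * n - 1) ^ 2) * h1⟩

theorem beta_smul_grad [IsReduced 𝓕] (h : A.IsTransverseSoliton ξ n α β b P W) :
    β • P = 0 := by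
  obtain ⟨k, hk⟩ := exists_inv (𝓕 := 𝓕) n h.ne_zero
  have h0 := h.beta_mul_eq_zero
  have hβ : ∀ X, 2 * A.der X β = (algebraMap ℝ 𝓕 k * A.der X b - 4 * A.inner X ξ) * β :=
    fun X ↦ by
      linear_combination algebraMap ℝ 𝓕 k * h.der_beta X
        - (2 * A.der X β + 4 * β * A.inner X ξ) * hk
  have hd : ∀ X, β * (A.der X (A.der W b) - 8 * (2 * n - 1) * A.der X b) = 0 := fun X ↦ by
    have h1 := congrArg (A.der X) h0
    simp only [Derivation.leibniz, map_add, map_sub, smul_eq_mul, A.der_ofNat, map_zero,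
      Derivation.leibniz_pow, Derivation.map_natCast, Derivation.map_one_eq_zero, mul_zero,
      add_zero, sub_zero, smul_zero] at h1
    apply eq_zero_of_two_mul
    linear_combination 2 * h1 - (A.der W b - 8 * (2 * n - 1) * b + 16 * (2 * n - 1) ^ 2) * hβ X
      - (algebraMap ℝ 𝓕 k * A.der X b - 4 * A.inner X ξ) * h0
  have hU : β • gradDer A b P W = (8 * (2 * n - 1) * β) • P := A.ext_inner fun X ↦ by
    simp only [map_smul, LinearMap.smul_apply, smul_eq_mul, h.isGradient X, h.isGradient_gradDer X]
    linear_combination hd X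
  set q := algebraMap ℝ 𝓕 k * β * A.der W b - 8 * β * b + 2 * A.inner P P with hq
  have key : ∀ X, (β * (q - 16 * (2 * n - 1) * β)) • (X - A.inner X ξ • ξ)
      - A.der X b • (4 * β) • P = 0 := fun X ↦ by
    have h1 := congrArg (A.conn X) hU
    have h2 : A.der X (8 * (2 * (n : 𝓕) - 1) * β) = 8 * (2 * n - 1) * A.der X β := by
      simp [A.der_ofNat]
    rw [A.conn_smul, A.conn_smul, h.conn_gradDer hk, ← hq, h.conn_grad, h2] at h1
    refine A.ext_inner fun Z ↦ ?_
    have h3 := congrArg (fun T ↦ A.inner T Z) h1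
    simp only [map_add, map_sub, map_smul, LinearMap.add_apply, LinearMap.sub_apply,
      LinearMap.smul_apply, smul_eq_mul, map_zero, LinearMap.zero_apply, h.isGradient Z,
      h.isGradient_gradDer Z, A.inner_comm ξ] at h3 ⊢
    apply eq_zero_of_two_mul
    linear_combination 2 * h3 + 2 * A.inner X ξ * hd Z + 2 * A.inner Z ξ * hd X
      - (A.der Z (A.der W b) - 8 * (2 * n - 1) * A.der Z b) * hβ X
      - (algebraMap ℝ 𝓕 k * A.der X b - 4 * A.inner X ξ) * hd Z
  have t1 := (((isTrace_id.sub (isTrace_inner_smul ξ ξ)).smul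
    (β * (q - 16 * (2 * n - 1) * β))).sub (isTrace_der_smul b ((4 * β) • P))).unique
    h.hasLocalFrames (t' := 0) (fun fr ↦ by simp [key])
  have t2 := congrArg (fun Z ↦ A.inner Z P) (key P)
  have t3 := h.isGradient P
  simp only [map_sub, map_smul, LinearMap.sub_apply, LinearMap.smul_apply, smul_eq_mul,
    h.inner_grad_field, map_zero, LinearMap.zero_apply, h.inner_self, Derivation.smul_apply,
    ← t3, zero_mul] at t1 t2
  push_cast at t1
  have h3 : β * A.inner P P ^ 2 = 0 := by
    refine eq_zero_of_natCast_mul (k := 8 * n - 4) (by have := h.ne_zero; omega) ?_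
    rw [Nat.cast_sub (by have := h.ne_zero; omega)]
    push_cast
    linear_combination A.inner P P * t1 - 2 * n * t2
  have h4 : β * A.inner P P = 0 := IsReduced.eq_zero _ ⟨2, by linear_combination β * h3⟩
  apply A.inner_self_eq_zero
  simp only [map_smul, LinearMap.smul_apply, smul_eq_mul]
  linear_combination β * h4

theorem beta_eq_zero [IsReduced 𝓕] (h : A.IsTransverseSoliton ξ n α β b P W) : β = 0 :=
  IsReduced.eq_zero _ ⟨3, by linear_combination h.eq_zero_of_smul_grad h.beta_smul_grad⟩

end IsTransverseSoliton

end MetricConnection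

end KenmotsuGeometry

noncomputable section

namespace KenmotsuGeometry

section Smooth

open scoped Topology

set_option linter.unusedSectionVars false

variable {E : Type*} [NormedAddCommGroup E] [NormedSpace ℝ E] [FiniteDimensional ℝ E]
  {M : Type*} [TopologicalSpace M] [ChartedSpace E M] [IsManifold 𝓘(ℝ, E) ∞ M]

theorem contMDiff_pair (g : Metric E M) {X Y : Π x : M, TangentSpace 𝓘(ℝ, E) x}
    (hX : SmoothField E X) (hY : SmoothField E Y) :
    ContMDiff 𝓘(ℝ, E) 𝓘(ℝ, ℝ) ∞ (pair g X Y) := by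
  let _ : RiemannianBundle (fun x : M ↦ TangentSpace 𝓘(ℝ, E) x) := ⟨g.toRiemannianMetric⟩
  exact ContMDiff.inner_bundle (E := fun x : M ↦ TangentSpace 𝓘(ℝ, E) x) (b := id) hX hY

theorem contMDiffOn_pair (g : Metric E M) {X Y : Π x : M, TangentSpace 𝓘(ℝ, E) x} {s : Set M}
    (hX : ContMDiffOn 𝓘(ℝ, E) 𝓘(ℝ, E).tangent ∞
      (fun y ↦ (⟨y, X y⟩ : TangentBundle 𝓘(ℝ, E) M)) s)
    (hY : ContMDiffOn 𝓘(ℝ, E) 𝓘(ℝ, E).tangent ∞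
      (fun y ↦ (⟨y, Y y⟩ : TangentBundle 𝓘(ℝ, E) M)) s) :
    ContMDiffOn 𝓘(ℝ, E) 𝓘(ℝ, ℝ) ∞ (pair g X Y) s := by
  let _ : RiemannianBundle (fun x : M ↦ TangentSpace 𝓘(ℝ, E) x) := ⟨g.toRiemannianMetric⟩
  exact ContMDiffOn.inner_bundle (E := fun x : M ↦ TangentSpace 𝓘(ℝ, E) x) (b := id) hX hY

theorem contMDiff_mvfderiv {f : M → ℝ} {X : Π x : M, TangentSpace 𝓘(ℝ, E) x}
    (hf : ContMDiff 𝓘(ℝ, E) 𝓘(ℝ, ℝ) ∞ f) (hX : SmoothField E X) :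
    ContMDiff 𝓘(ℝ, E) 𝓘(ℝ, ℝ) ∞ (fun x ↦ mvfderiv 𝓘(ℝ, E) f x (X x)) :=
  (contMDiff_snd_tangentBundle_modelSpace ℝ 𝓘(ℝ, ℝ)).comp
    ((hf.contMDiff_tangentMap (m := ∞) le_rfl).comp hX)

theorem contMDiff_mlieBracket {X Y : Π x : M, TangentSpace 𝓘(ℝ, E) x}
    (hX : SmoothField E X) (hY : SmoothField E Y) : SmoothField E (mlieBracket 𝓘(ℝ, E) X Y) := by
  have : IsManifold 𝓘(ℝ, E) (((⊤ : ℕ∞) : WithTop ℕ∞) + 1) M := ‹IsManifold 𝓘(ℝ, E) ∞ M›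
  have : IsManifold 𝓘(ℝ, E) (minSmoothness ℝ 2) M := by
    rw [minSmoothness_of_isRCLikeNormedField]
    exact .of_le (n := ∞) ENat.LEInfty.out
  exact ContDiff.mlieBracket_vectorField (m := ⊤) (n := ⊤) hX hY (by simp)

theorem contMDiffOn_det {ι : Type*} [Fintype ι] [DecidableEq ι] {s : Set M} {G : M → Matrix ι ι ℝ}
    (hG : ∀ i j, ContMDiffOn 𝓘(ℝ, E) 𝓘(ℝ, ℝ) ∞ (fun x ↦ G x i j) s) :
    ContMDiffOn 𝓘(ℝ, E) 𝓘(ℝ, ℝ) ∞ (fun x ↦ (G x).det) s := by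
  simp only [Matrix.det_apply']
  exact contMDiffOn_finsetSum fun p _ ↦ contMDiffOn_const.mul
    (contMDiffOn_finsetProd fun i _ ↦ hG _ _)

theorem contMDiffOn_inv {ι : Type*} [Fintype ι] [DecidableEq ι] {s : Set M} {G : M → Matrix ι ι ℝ}
    (hG : ∀ i j, ContMDiffOn 𝓘(ℝ, E) 𝓘(ℝ, ℝ) ∞ (fun x ↦ G x i j) s)
    (hdet : ∀ x ∈ s, (G x).det ≠ 0) (i j : ι) :
    ContMDiffOn 𝓘(ℝ, E) 𝓘(ℝ, ℝ) ∞ (fun x ↦ (G x)⁻¹ i j) s := by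
  simp only [Matrix.inv_def, Matrix.smul_apply, Matrix.adjugate_apply, Ring.inverse_eq_inv',
    smul_eq_mul]
  refine ContMDiffOn.mul ((contMDiffOn_det hG).inv₀ hdet) (contMDiffOn_det fun k l ↦ ?_)
  by_cases hk : k = j
  · subst hk
    simpa using contMDiffOn_const
  · simpa [Matrix.updateRow_apply, hk] using hG k l

variable (E M) in
/-- The ring of smooth functions on `M`. -/
abbrev SmoothFunctions : Type _ := C^∞⟮𝓘(ℝ, E), M; 𝓘(ℝ, ℝ), ℝ⟯

variable (E M) in
/-- The smooth vector fields on `M`. -/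
abbrev SmoothFields : Type _ := Cₛ^∞⟮𝓘(ℝ, E); E, fun x : M ↦ TangentSpace 𝓘(ℝ, E) x⟯

instance : SMul (SmoothFunctions E M) (SmoothFields E M) :=
  ⟨fun f X ↦ ⟨fun x ↦ f x • X x, f.contMDiff.smul_section X.contMDiff⟩⟩

@[simp]
theorem SmoothFields.smul_apply (f : SmoothFunctions E M) (X : SmoothFields E M) (x : M) :
    (f • X) x = f x • X x := rfl

instance : Module (SmoothFunctions E M) (SmoothFields E M) where
  smul_add f X Y := by ext x; exact smul_add (f x) (X x) (Y x)
  add_smul f f' X := by ext x; exact add_smul (f x) (f' x) (X x)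
  mul_smul f f' X := by ext x; exact mul_smul (f x) (f' x) (X x)
  one_smul X := by ext x; exact one_smul ℝ (X x)
  zero_smul X := by ext x; exact zero_smul ℝ (X x)
  smul_zero f := by ext x; exact smul_zero (f x)

instance : IsReduced (SmoothFunctions E M) where
  eq_zero f := by
    rintro ⟨k, hk⟩
    ext x
    exact eq_zero_of_pow_eq_zero (congrFun (congrArg DFunLike.coe hk) x : f x ^ k = 0)

/-- Vector fields `vec` and `dual` with `∑ i, g(v, dual i) vec i = cutoff • v`. -/
structure CutoffFrame (g : Metric E M) where
  /-- the frame -/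
  vec : Fin (finrank ℝ E) → SmoothFields E M
  /-- the dual frame -/
  dual : Fin (finrank ℝ E) → SmoothFields E M
  /-- the cutoff function -/
  cutoff : SmoothFunctions E M
  sum_smul : ∀ (x : M) (v : TangentSpace 𝓘(ℝ, E) x),
    ∑ i, g.inner x v (dual i x) • vec i x = cutoff x • v

theorem CutoffFrame.sum_inner {g : Metric E M} (fr : CutoffFrame g) (x : M)
    (T : TangentSpace 𝓘(ℝ, E) x →ₗ[ℝ] TangentSpace 𝓘(ℝ, E) x) :
    ∑ i, g.inner x (T (fr.vec i x)) (fr.dual i x) = fr.cutoff x * LinearMap.trace ℝ _ T := by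
  have : FiniteDimensional ℝ (TangentSpace 𝓘(ℝ, E) x) := inferInstanceAs (FiniteDimensional ℝ E)
  rw [← smul_eq_mul, ← map_smul]
  have : fr.cutoff x • T = ∑ i, ((g.inner x (fr.dual i x)).toLinearMap.smulRight (T (fr.vec i x))) := by
    ext v
    have h := congrArg T (fr.sum_smul x v)
    simp only [map_sum, map_smul] at h
    simp [← h, g.symm x v]
  rw [this, map_sum]
  simp [LinearMap.trace_smulRight, g.symm x (T _)]

/-- The Gram matrix of a family of tangent vectors. -/
def gram (g : Metric E M) {ι : Type*} (s : ι → Π x : M, TangentSpace 𝓘(ℝ, E) x) (x : M) :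
    Matrix ι ι ℝ := Matrix.of fun i j ↦ g.inner x (s i x) (s j x)

theorem det_gram_ne_zero (g : Metric E M) {ι : Type*} [Fintype ι] [DecidableEq ι]
    {s : ι → Π x : M, TangentSpace 𝓘(ℝ, E) x} {x : M} (hs : LinearIndependent ℝ (s · x)) :
    (gram g s x).det ≠ 0 := by
  intro h
  obtain ⟨c, hc0, hc⟩ := Matrix.exists_mulVec_eq_zero_iff.2 h
  apply hc0
  have h0 : ∑ j, c j • s j x = 0 := by
    by_contra hne
    have hpos := g.pos x _ hne
    have : g.inner x (∑ j, c j • s j x) (∑ j, c j • s j x) = ∑ i, c i * (gram g s x).mulVec c i := by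
      simp only [map_sum, map_smul, _root_.sum_apply, _root_.smul_apply,
        Matrix.mulVec, dotProduct, gram, Matrix.of_apply, smul_eq_mul, Finset.mul_sum]
      rw [Finset.sum_comm]
      exact Finset.sum_congr rfl fun i _ ↦ Finset.sum_congr rfl fun j _ ↦ by ring
    rw [this, hc] at hpos
    simp at hpos
  ext i
  exact Fintype.linearIndependent_iff.1 hs c h0 i

theorem exists_cutoffFrame [T2Space M] (g : Metric E M) (x : M) :
    ∃ fr : CutoffFrame g, ∀ᶠ y in 𝓝 x, fr.cutoff y = 1 := by
  classical
  let e := trivializationAt E (fun x : M ↦ TangentSpace 𝓘(ℝ, E) x) x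
  let b := finBasis ℝ E
  have hfr := e.isLocalFrameOn_localFrame_baseSet 𝓘(ℝ, E) ∞ b
  let s := e.localFrame b
  let ρ : SmoothBumpFunction 𝓘(ℝ, E) x := Classical.arbitrary _
  have hρ : tsupport ρ ⊆ e.baseSet := ρ.tsupport_subset_chartAt_source
  have hG : ∀ i j, ContMDiffOn 𝓘(ℝ, E) 𝓘(ℝ, ℝ) ∞ (fun x ↦ gram g s x i j) e.baseSet := fun i j ↦
    contMDiffOn_pair g (hfr.contMDiffOn i) (hfr.contMDiffOn j)
  have hdet : ∀ y ∈ e.baseSet, (gram g s y).det ≠ 0 := fun y hy ↦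
    det_gram_ne_zero g (hfr.linearIndependent hy)
  let t : Fin (finrank ℝ E) → Π x : M, TangentSpace 𝓘(ℝ, E) x := fun i y ↦
    ∑ j, (gram g s y)⁻¹ i j • s j y
  have ht : ∀ i, ContMDiffOn 𝓘(ℝ, E) 𝓘(ℝ, E).tangent ∞
      (fun y ↦ (⟨y, t i y⟩ : TangentBundle 𝓘(ℝ, E) M)) e.baseSet := fun i ↦
    ContMDiffOn.sum_section fun j _ ↦
      (contMDiffOn_inv hG hdet i j).smul_section (hfr.contMDiffOn j)
  refine ⟨⟨fun i ↦ ⟨_, ρ.contMDiff.contMDiffOn.smul_section_of_tsupport e.open_baseSet hρ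
    (hfr.contMDiffOn i)⟩, fun i ↦ ⟨_, ρ.contMDiff.contMDiffOn.smul_section_of_tsupport
    e.open_baseSet hρ (ht i)⟩, ⟨fun y ↦ ρ y * ρ y, ρ.contMDiff.mul ρ.contMDiff⟩, ?_⟩, ?_⟩
  · intro y v
    show ∑ i, g.inner y v (ρ y • t i y) • ρ y • s i y = (ρ y * ρ y) • v
    by_cases hy : y ∈ e.baseSet
    · have hst : ∀ k i, g.inner y (s k y) (t i y) = if k = i then 1 else 0 := fun k i ↦ by
        have h1 := congrFun (congrFun (Matrix.nonsing_inv_mul (gram g s y)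
          (isUnit_iff_ne_zero.2 (hdet y hy))) i) k
        simp only [Matrix.mul_apply, Matrix.one_apply, gram, Matrix.of_apply] at h1
        simp only [t, map_sum, map_smul, smul_eq_mul, eq_comm (a := k), ← h1]
        exact Finset.sum_congr rfl fun j _ ↦ by rw [g.symm y (s k y)]; rfl
      obtain ⟨c, rfl⟩ : ∃ c : Fin (finrank ℝ E) → ℝ, v = ∑ k, c k • s k y :=
        ⟨fun k ↦ (hfr.toBasisAt hy).repr v k,
          ((hfr.toBasisAt hy).sum_repr v).symm.trans (by simp [s])⟩
      simp only [map_sum, map_smul, _root_.sum_apply, _root_.smul_apply, hst, smul_eq_mul,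
        mul_ite, mul_one, mul_zero, Finset.sum_ite_eq', Finset.mem_univ, if_true, Finset.smul_sum]
      exact Finset.sum_congr rfl fun i _ ↦ by module
    · have : ρ y = 0 := image_eq_zero_of_notMem_tsupport fun h ↦ hy (hρ h)
      simp [this]
  · filter_upwards [ρ.eventuallyEq_one] with y hy
    simp [hy]

end Smooth

end KenmotsuGeometry

end

noncomputable section

namespace KenmotsuGeometry

section Connection

open scoped Topology

set_option linter.unusedSectionVars false

variable {E : Type*} [NormedAddCommGroup E] [NormedSpace ℝ E] [FiniteDimensional ℝ E]
  {M : Type*} [TopologicalSpace M] [T2Space M] [ChartedSpace E M] [IsManifold 𝓘(ℝ, E) ∞ M]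

theorem smoothField_of_pair (g : Metric E M) {X : Π x : M, TangentSpace 𝓘(ℝ, E) x}
    (hX : ∀ Z : SmoothFields E M, ContMDiff 𝓘(ℝ, E) 𝓘(ℝ, ℝ) ∞ (pair g X Z)) :
    SmoothField E X := by
  intro x
  obtain ⟨fr, hfr⟩ := exists_cutoffFrame g x
  have h : SmoothField E (fun y ↦ ∑ i, g.inner y (X y) (fr.dual i y) • fr.vec i y) :=
    ContMDiff.sum_section fun i _ ↦ (hX (fr.dual i)).smul_section (fr.vec i).contMDiff
  refine (h x).congr_of_eventuallyEq ?_
  filter_upwards [hfr] with y hy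
  rw [fr.sum_smul, hy, one_smul]

theorem contMDiff_leviCivita (g : Metric E M) {X Y : Π x : M, TangentSpace 𝓘(ℝ, E) x}
    (hX : SmoothField E X) (hY : SmoothField E Y) :
    SmoothField E (fun x ↦ leviCivita g Y x (X x)) := by
  have hd {Z : Π x : M, TangentSpace 𝓘(ℝ, E) x} (hZ : SmoothField E Z) (x : M) :
      DiffFieldAt E Z x := hZ.mdifferentiable (by simp) x
  refine smoothField_of_pair g fun Z ↦ ?_
  have hZ : SmoothField E (Z : Π x : M, TangentSpace 𝓘(ℝ, E) x) := Z.contMDiff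
  have : pair g (fun x ↦ leviCivita g Y x (X x)) Z = koszul g X Y Z :=
    funext fun x ↦ inner_leviCivita g (hd hX x) (hd hY x) (hd hZ x)
  rw [this]
  unfold koszul
  exact ((((((contMDiff_mvfderiv (contMDiff_pair g hY hZ) hX).add
    (contMDiff_mvfderiv (contMDiff_pair g hZ hX) hY)).sub
    (contMDiff_mvfderiv (contMDiff_pair g hX hY) hZ)).add
    (contMDiff_pair g (contMDiff_mlieBracket hX hY) hZ)).sub
    (contMDiff_pair g (contMDiff_mlieBracket hY hZ) hX)).add
    (contMDiff_pair g (contMDiff_mlieBracket hZ hX) hY)).div_const 2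

namespace SmoothFields

/-- The derivation of the ring of smooth functions given by a vector field. -/
def derivation (X : SmoothFields E M) :
    Derivation ℝ (SmoothFunctions E M) (SmoothFunctions E M) :=
  Derivation.mk'
    { toFun := fun f ↦ ⟨fun x ↦ mvfderiv 𝓘(ℝ, E) f x (X x), contMDiff_mvfderiv f.2 X.contMDiff⟩
      map_add' := fun f f' ↦ by
        ext x
        exact congrArg (· (X x)) (mvfderiv_add f.mdifferentiableAt f'.mdifferentiableAt)
      map_smul' := fun c f ↦ by
        ext x
        have := congrArg (· (X x)) (mvfderiv_mul (I := 𝓘(ℝ, E)) (f := fun _ ↦ c) (x := x)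
          mdifferentiableAt_const f.mdifferentiableAt)
        exact this.trans (by simp [mvfderiv_const]; rfl) }
    fun f f' ↦ by
      ext x
      exact congrArg (· (X x)) (mvfderiv_mul f.mdifferentiableAt f'.mdifferentiableAt)

theorem derivation_apply (X : SmoothFields E M) (f : SmoothFunctions E M) (x : M) :
    X.derivation f x = mvfderiv 𝓘(ℝ, E) f x (X x) := rfl

/-- The Lie bracket of smooth vector fields. -/
def lie (X Y : SmoothFields E M) : SmoothFields E M :=
  ⟨mlieBracket 𝓘(ℝ, E) X Y, contMDiff_mlieBracket X.contMDiff Y.contMDiff⟩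

theorem lie_apply (X Y : SmoothFields E M) (x : M) :
    lie X Y x = mlieBracket 𝓘(ℝ, E) X Y x := rfl

theorem lie_add_right (X Y Z : SmoothFields E M) : lie X (Y + Z) = lie X Y + lie X Z := by
  ext x
  exact mlieBracket_add_right Y.mdifferentiableAt Z.mdifferentiableAt

theorem lie_smul_right (X : SmoothFields E M) (f : SmoothFunctions E M) (Y : SmoothFields E M) :
    lie X (f • Y) = f • lie X Y + X.derivation f • Y := by
  ext x
  rw [lie_apply]
  refine (mlieBracket_smul_right f.mdifferentiableAt Y.mdifferentiableAt).trans ?_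
  exact add_comm _ _

theorem lie_jacobi (X Y Z : SmoothFields E M) :
    lie X (lie Y Z) = lie (lie X Y) Z + lie Y (lie X Z) := by
  have : IsManifold 𝓘(ℝ, E) (minSmoothness ℝ 3) M := by
    rw [minSmoothness_of_isRCLikeNormedField]
    exact .of_le (n := ∞) ENat.LEInfty.out
  have h : ∀ X : SmoothFields E M, ContMDiff 𝓘(ℝ, E) 𝓘(ℝ, E).tangent (minSmoothness ℝ 2)
      (fun y ↦ (⟨y, X y⟩ : TangentBundle 𝓘(ℝ, E) M)) := fun X ↦ by
    rw [minSmoothness_of_isRCLikeNormedField]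
    exact X.contMDiff.of_le ENat.LEInfty.out
  ext x
  exact leibniz_identity_mlieBracket_apply (h X x) (h Y x) (h Z x)

theorem derivation_lie (X Y : SmoothFields E M) (f : SmoothFunctions E M) :
    (lie X Y).derivation f = X.derivation (Y.derivation f) - Y.derivation (X.derivation f) := by
  have h : ∀ Z : SmoothFields E M, ((lie X Y).derivation f -
      (X.derivation (Y.derivation f) - Y.derivation (X.derivation f))) • Z = 0 := fun Z ↦ by
    have h1 := lie_jacobi X Y (f • Z)
    simp only [lie_smul_right, lie_add_right] at h1
    rw [lie_jacobi X Y Z] at h1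
    linear_combination (norm := module) -h1
  ext x
  by_contra hne
  have hZ : ∀ Z : SmoothFields E M, Z x = 0 := fun Z ↦
    (smul_eq_zero.1 (congrArg (fun W : SmoothFields E M ↦ W x) (h Z))).resolve_left
      (sub_ne_zero.2 hne)
  refine hne ?_
  simp only [ContMDiffMap.coe_sub, Pi.sub_apply, derivation_apply, hZ, map_zero, sub_zero]

/-- The covariant derivative `∇_X Y` of smooth vector fields. -/
def nabla (g : Metric E M) (X Y : SmoothFields E M) : SmoothFields E M :=
  ⟨fun x ↦ leviCivita g Y x (X x), contMDiff_leviCivita g X.contMDiff Y.contMDiff⟩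

theorem nabla_sub_nabla (g : Metric E M) (X Y : SmoothFields E M) :
    nabla g X Y - nabla g Y X = lie X Y := by
  ext x
  exact (CovariantDerivative.torsion_eq_zero_iff _).1 (leviCivita_torsion g)
    X.mdifferentiableAt Y.mdifferentiableAt

end SmoothFields

open SmoothFields

/-- The smooth functions and vector fields of a Riemannian manifold with its Levi-Civita
connection. -/
def metricConnection (g : Metric E M) :
    MetricConnection (SmoothFunctions E M) (SmoothFields E M) where
  der :=
    { toFun := derivation
      map_add' := fun X Y ↦ by
        ext f x
        exact map_add (mvfderiv 𝓘(ℝ, E) f x) (X x) (Y x)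
      map_smul' := fun a X ↦ by
        ext f x
        exact map_smul (mvfderiv 𝓘(ℝ, E) f x) (a x) (X x) }
  conn :=
    { toFun := fun X ↦
        { toFun := nabla g X
          map_zero' := by
            ext x
            exact congrArg (fun T ↦ T x (X x)) (leviCivita g).zero
          map_add' := fun Y Z ↦ by
            ext x
            exact congrArg (· (X x)) ((leviCivita g).isCovariantDerivativeOnUniv.add
              Y.mdifferentiableAt Z.mdifferentiableAt) }
      map_add' := fun X Y ↦ by
        ext Z x
        exact map_add (leviCivita g Z x) (X x) (Y x)
      map_smul' := fun a X ↦ by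
        ext Z x
        exact map_smul (leviCivita g Z x) (a x) (X x) }
  inner := LinearMap.mk₂ _
    (fun X Y ↦ ⟨pair g X Y, contMDiff_pair g X.contMDiff Y.contMDiff⟩)
    (fun X X' Y ↦ by ext x; exact congrFun (pair_add_left g X X' Y) x)
    (fun a X Y ↦ by ext x; exact congrFun (pair_smul_left g a X Y) x)
    (fun X Y Y' ↦ by ext x; exact congrFun (pair_add_right g X Y Y') x)
    (fun a X Y ↦ by ext x; exact congrFun (pair_smul_right g a X Y) x)
  conn_smul X f Y := by
    ext x
    exact congrArg (· (X x)) ((leviCivita g).isCovariantDerivativeOnUniv.leibniz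
      Y.mdifferentiableAt f.mdifferentiableAt)
  inner_comm X Y := by
    ext x
    exact g.symm x _ _
  inner_self_eq_zero X h := by
    ext x
    by_contra hne
    exact (g.pos x (X x) hne).ne' (congrArg (fun f : SmoothFunctions E M ↦ f x) h)
  der_inner X Y Z := by
    ext x
    exact leviCivita_metric g X.mdifferentiableAt Y.mdifferentiableAt Z.mdifferentiableAt
  der_bracket X Y f := by
    show (nabla g X Y - nabla g Y X).derivation f = _
    rw [nabla_sub_nabla]
    exact derivation_lie X Y f
  jacobi X Y Z := by
    show nabla g X (nabla g Y Z - nabla g Z Y) - nabla g (nabla g Y Z - nabla g Z Y) X =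
      (nabla g (nabla g X Y - nabla g Y X) Z - nabla g Z (nabla g X Y - nabla g Y X)) +
      (nabla g Y (nabla g X Z - nabla g Z X) - nabla g (nabla g X Z - nabla g Z X) Y)
    simp only [nabla_sub_nabla]
    exact lie_jacobi X Y Z

theorem metricConnection_inner_apply (g : Metric E M) (X Y : SmoothFields E M) (x : M) :
    (metricConnection g).inner X Y x = g.inner x (X x) (Y x) := rfl

theorem metricConnection_bracket (g : Metric E M) (X Y : SmoothFields E M) :
    (metricConnection g).bracket X Y = lie X Y := nabla_sub_nabla g X Y

theorem metricConnection_curv_apply (g : Metric E M) (X Y Z : SmoothFields E M) (x : M) :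
    (metricConnection g).curv X Y Z x = curvature g X Y Z x := by
  rw [MetricConnection.curv, metricConnection_bracket]
  rfl

end Connection

end KenmotsuGeometry

end

noncomputable section

namespace KenmotsuGeometry

section Ricci

open scoped Topology

set_option linter.unusedSectionVars false

variable {E : Type*} [NormedAddCommGroup E] [NormedSpace ℝ E] [FiniteDimensional ℝ E]
  {M : Type*} [TopologicalSpace M] [T2Space M] [ChartedSpace E M] [IsManifold 𝓘(ℝ, E) ∞ M]

theorem SmoothFields.exists_eventuallyEq_extend (x : M) (v : TangentSpace 𝓘(ℝ, E) x) :
    ∃ X : SmoothFields E M, ∀ᶠ y in 𝓝 x, X y = FiberBundle.extend E v y := by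
  obtain ⟨s, hs, hsmooth⟩ := FiberBundle.exists_contMDiffOn_extend (k := ∞) 𝓘(ℝ, E) E v
  obtain ⟨ρ, -, hρ⟩ := (SmoothBumpFunction.nhds_basis_tsupport (I := 𝓘(ℝ, E)) x).mem_iff.1
    (interior_mem_nhds.2 hs)
  refine ⟨⟨_, ρ.contMDiff.contMDiffOn.smul_section_of_tsupport isOpen_interior hρ
    (hsmooth.mono interior_subset)⟩, ?_⟩
  filter_upwards [ρ.eventuallyEq_one] with y hy
  show ρ y • FiberBundle.extend E v y = _
  rw [hy, Pi.one_apply, one_smul]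

theorem SmoothFields.exists_apply_eq (x : M) (v : TangentSpace 𝓘(ℝ, E) x) :
    ∃ X : SmoothFields E M, X x = v := by
  obtain ⟨X, hX⟩ := SmoothFields.exists_eventuallyEq_extend x v
  exact ⟨X, by rw [hX.self_of_nhds, FiberBundle.extend_apply_self]⟩

theorem leviCivita_congr (g : Metric E M) {Y Y' : Π x : M, TangentSpace 𝓘(ℝ, E) x} {x : M}
    (hY : DiffFieldAt E Y x) (h : ∀ᶠ y in 𝓝 x, Y y = Y' y) :
    leviCivita g Y x = leviCivita g Y' x := by
  refine (leviCivita g).isCovariantDerivativeOnUniv.congr_of_eventuallyEq hY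
    (hY.congr_of_eventuallyEq ?_) Filter.univ_mem h
  filter_upwards [h] with y hy
  rw [hy]

theorem curvature_congr (g : Metric E M) (X Y Z : SmoothFields E M)
    {X' Y' Z' : Π x : M, TangentSpace 𝓘(ℝ, E) x} {x : M} (hX : ∀ᶠ y in 𝓝 x, X y = X' y)
    (hY : ∀ᶠ y in 𝓝 x, Y y = Y' y) (hZ : ∀ᶠ y in 𝓝 x, Z y = Z' y) :
    curvature g X Y Z x = curvature g X' Y' Z' x := by
  have h : ∀ (W : SmoothFields E M) {W' : Π x : M, TangentSpace 𝓘(ℝ, E) x},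
      (∀ᶠ y in 𝓝 x, W y = W' y) →
      leviCivita g (fun y ↦ leviCivita g Z y (W y)) x =
        leviCivita g (fun y ↦ leviCivita g Z' y (W' y)) x := fun W W' hW ↦ by
    refine leviCivita_congr g (SmoothFields.nabla g W Z).mdifferentiableAt ?_
    filter_upwards [hZ.eventually_nhds, hW] with y hy hWy
    rw [leviCivita_congr g Z.mdifferentiableAt hy, hWy]
  rw [curvature, curvature, h X hX, h Y hY, leviCivita_congr g Z.mdifferentiableAt hZ,
    hX.self_of_nhds, hY.self_of_nhds, Filter.EventuallyEq.mlieBracket_vectorField_eq hX hY]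

theorem SmoothFields.sum_apply {ι : Type*} (s : Finset ι) (X : ι → SmoothFields E M) (x : M) :
    (∑ i ∈ s, X i) x = ∑ i ∈ s, X i x := by
  have h := map_sum (ContMDiffSection.coeAddHom 𝓘(ℝ, E) E ∞
    (fun x : M ↦ TangentSpace 𝓘(ℝ, E) x)) X s
  exact (congrFun h x).trans (Finset.sum_apply x s _)

theorem SmoothFunctions.sum_apply {ι : Type*} (s : Finset ι) (f : ι → SmoothFunctions E M)
    (x : M) : (∑ i ∈ s, f i) x = ∑ i ∈ s, f i x := by
  have h := map_sum (ContMDiffMap.coeFnRingHom (I := 𝓘(ℝ, E)) (N := M) (n := ∞)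
    (I' := 𝓘(ℝ, ℝ)) (R := ℝ)) f s
  exact (congrFun h x).trans (Finset.sum_apply x s _)

theorem CutoffFrame.sum_inner_smul {g : Metric E M} (fr : CutoffFrame g) (X : SmoothFields E M) :
    ∑ i, (metricConnection g).inner X (fr.dual i) • fr.vec i = fr.cutoff • X := by
  ext y
  rw [SmoothFields.sum_apply]
  exact fr.sum_smul y (X y)

/-- A map on vector fields that is linear over the smooth functions acts pointwise. -/
theorem SmoothFields.map_apply_eq (g : Metric E M) (T : SmoothFields E M → SmoothFields E M)
    (hadd : ∀ X Y, T (X + Y) = T X + T Y)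
    (hsmul : ∀ (f : SmoothFunctions E M) X, T (f • X) = f • T X)
    {X Y : SmoothFields E M} {x : M} (h : X x = Y x) : T X x = T Y x := by
  let L : SmoothFields E M →ₗ[SmoothFunctions E M] SmoothFields E M :=
    { toFun := T, map_add' := hadd, map_smul' := hsmul }
  obtain ⟨fr, hfr⟩ := exists_cutoffFrame g x
  have key : ∀ X : SmoothFields E M,
      L X x = ∑ i, g.inner x (X x) (fr.dual i x) • L (fr.vec i) x := fun X ↦ by
    have h2 := congrArg (fun W ↦ L W x) (fr.sum_inner_smul X)
    simp only [map_sum, map_smul, SmoothFields.sum_apply, SmoothFields.smul_apply,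
      hfr.self_of_nhds, one_smul] at h2
    exact h2.symm
  exact (key X).trans (h ▸ (key Y).symm)

theorem curvatureAt_apply (g : Metric E M) (X Y Z : SmoothFields E M) (x : M) :
    curvatureAt g x (X x) (Y x) (Z x) = (metricConnection g).curv X Y Z x := by
  obtain ⟨X', hX⟩ := SmoothFields.exists_eventuallyEq_extend x (X x)
  obtain ⟨Y', hY⟩ := SmoothFields.exists_eventuallyEq_extend x (Y x)
  obtain ⟨Z', hZ⟩ := SmoothFields.exists_eventuallyEq_extend x (Z x)
  have hX' : X' x = X x := by rw [hX.self_of_nhds, FiberBundle.extend_apply_self]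
  have hY' : Y' x = Y x := by rw [hY.self_of_nhds, FiberBundle.extend_apply_self]
  have hZ' : Z' x = Z x := by rw [hZ.self_of_nhds, FiberBundle.extend_apply_self]
  let A := metricConnection g
  rw [curvatureAt, ← curvature_congr g X' Y' Z' hX hY hZ, ← metricConnection_curv_apply]
  calc A.curv X' Y' Z' x = A.curv X Y' Z' x := SmoothFields.map_apply_eq g
        (fun X ↦ A.curv X Y' Z') (fun _ _ ↦ A.curv_add_left ..) (fun _ _ ↦ A.curv_smul_left ..) hX'
    _ = A.curv X Y Z' x := SmoothFields.map_apply_eq g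
        (fun Y ↦ A.curv X Y Z') (fun _ _ ↦ A.curv_add_middle ..)
        (fun _ _ ↦ A.curv_smul_middle ..) hY'
    _ = A.curv X Y Z x := SmoothFields.map_apply_eq g
        (fun Z ↦ A.curv X Y Z) (fun _ _ ↦ A.curv_add_right ..) (fun _ _ ↦ A.curv_smul_right ..) hZ'

/-- The linear map `u ↦ R(u, v)w`. -/
def curvatureMap (g : Metric E M) (x : M) (v w : TangentSpace 𝓘(ℝ, E) x) :
    TangentSpace 𝓘(ℝ, E) x →ₗ[ℝ] TangentSpace 𝓘(ℝ, E) x where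
  toFun u := curvatureAt g x u v w
  map_add' u u' := by
    obtain ⟨X, rfl⟩ := SmoothFields.exists_apply_eq x u
    obtain ⟨X', rfl⟩ := SmoothFields.exists_apply_eq x u'
    obtain ⟨Y, rfl⟩ := SmoothFields.exists_apply_eq x v
    obtain ⟨Z, rfl⟩ := SmoothFields.exists_apply_eq x w
    have h := curvatureAt_apply g (X + X') Y Z x
    rw [MetricConnection.curv_add_left] at h
    rw [curvatureAt_apply, curvatureAt_apply]
    exact h
  map_smul' c u := by
    obtain ⟨X, rfl⟩ := SmoothFields.exists_apply_eq x u
    obtain ⟨Y, rfl⟩ := SmoothFields.exists_apply_eq x v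
    obtain ⟨Z, rfl⟩ := SmoothFields.exists_apply_eq x w
    have h := curvatureAt_apply g (algebraMap ℝ (SmoothFunctions E M) c • X) Y Z x
    rw [MetricConnection.curv_smul_left] at h
    rw [curvatureAt_apply]
    exact h

theorem ricci_eq_trace (g : Metric E M) (x : M) (v w : TangentSpace 𝓘(ℝ, E) x) :
    ricci g x v w = LinearMap.trace ℝ _ (curvatureMap g x v w) := by
  rw [LinearMap.trace_eq_matrix_trace ℝ (tangentBasis E x), Matrix.trace]
  simp only [Matrix.diag_apply, LinearMap.toMatrix_apply]
  rfl

/-- A cutoff frame as a frame of the module of vector fields. -/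
def CutoffFrame.toFrame {g : Metric E M} (fr : CutoffFrame g) :
    (metricConnection g).Frame (finrank ℝ E) where
  vec := fr.vec
  dual := fr.dual
  cutoff := fr.cutoff
  sum_smul := fr.sum_inner_smul
  sum_inner := by
    ext x
    rw [SmoothFunctions.sum_apply]
    have : FiniteDimensional ℝ (TangentSpace 𝓘(ℝ, E) x) := inferInstanceAs (FiniteDimensional ℝ E)
    have h := fr.sum_inner x LinearMap.id
    rw [LinearMap.trace_id] at h
    exact h.trans (congrArg (fr.cutoff x * ·) (congrFun (map_natCast (ContMDiffMap.coeFnRingHom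
      (I := 𝓘(ℝ, E)) (N := M) (n := ∞) (I' := 𝓘(ℝ, ℝ)) (R := ℝ)) (finrank ℝ E)) x).symm)

/-- A frame of the module of vector fields as a cutoff frame. -/
def CutoffFrame.ofFrame {g : Metric E M} (fr : (metricConnection g).Frame (finrank ℝ E)) :
    CutoffFrame g where
  vec := fr.vec
  dual := fr.dual
  cutoff := fr.cutoff
  sum_smul x v := by
    obtain ⟨X, rfl⟩ := SmoothFields.exists_apply_eq x v
    have h := congrArg (fun W : SmoothFields E M ↦ W x) (fr.sum_smul X)
    simp only [SmoothFields.sum_apply] at h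
    exact h

theorem hasLocalFrames (g : Metric E M) :
    (metricConnection g).HasLocalFrames (finrank ℝ E) := by
  intro a ha
  ext x
  obtain ⟨fr, hfr⟩ := exists_cutoffFrame g x
  have h : fr.cutoff x * a x = 0 :=
    congrArg (fun f : SmoothFunctions E M ↦ f x) (ha fr.toFrame)
  rwa [hfr.self_of_nhds, one_mul] at h

theorem isTrace_curv (g : Metric E M) (Y Z : SmoothFields E M) (S : SmoothFunctions E M)
    (hS : ∀ x, ricci g x (Y x) (Z x) = S x) :
    (metricConnection g).IsTrace (finrank ℝ E) (fun X ↦ (metricConnection g).curv X Y Z) S := by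
  intro fr
  ext x
  rw [SmoothFunctions.sum_apply]
  have h := (CutoffFrame.ofFrame fr).sum_inner x (curvatureMap g x (Y x) (Z x))
  rw [← ricci_eq_trace, hS] at h
  refine Eq.trans (Finset.sum_congr rfl fun i _ ↦ ?_) h
  rw [metricConnection_inner_apply, ← curvatureAt_apply]
  rfl

end Ricci

end KenmotsuGeometry

end

noncomputable section

namespace KenmotsuGeometry

section Kenmotsu

set_option linter.unusedSectionVars false

variable {E : Type*} [NormedAddCommGroup E] [NormedSpace ℝ E] [FiniteDimensional ℝ E]
  {M : Type*} [TopologicalSpace M] [ChartedSpace E M] [IsManifold 𝓘(ℝ, E) ∞ M]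
  {g : Metric E M} {φ : Π x : M, TangentSpace 𝓘(ℝ, E) x →L[ℝ] TangentSpace 𝓘(ℝ, E) x}
  {ξ : Π x : M, TangentSpace 𝓘(ℝ, E) x} {η : Π x : M, TangentSpace 𝓘(ℝ, E) x →L[ℝ] ℝ}

theorem IsAlmostContactMetric.inner_xi_xi (h : IsAlmostContactMetric g φ ξ η) (x : M) :
    g.inner x (ξ x) (ξ x) = 1 := by
  rw [← h.eta_eq, h.eta_xi]

theorem IsAlmostContactMetric.phi_xi (h : IsAlmostContactMetric g φ ξ η) (x : M) :
    φ x (ξ x) = 0 := by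
  by_contra hne
  have := g.pos x _ hne
  rw [h.inner_phi_phi, h.inner_xi_xi, h.eta_xi] at this
  norm_num at this

theorem IsAlmostContactMetric.eta_phi (h : IsAlmostContactMetric g φ ξ η) (x : M)
    (v : TangentSpace 𝓘(ℝ, E) x) : η x (φ x v) = 0 := by
  have h1 := h.phi_phi x (φ x v)
  rw [h.phi_phi x v, map_add, map_neg, map_smul, h.phi_xi, smul_zero] at h1
  have h2 : η x (φ x v) • ξ x = 0 := add_left_cancel h1.symm
  simpa [h.eta_xi] using congrArg (η x) h2

theorem IsKenmotsu.leviCivita_xi (h : IsKenmotsu g φ ξ η) {X : Π x : M, TangentSpace 𝓘(ℝ, E) x}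
    {x : M} (hX : DiffFieldAt E X x) :
    leviCivita g ξ x (X x) = X x - g.inner x (X x) (ξ x) • ξ x := by
  have hξ : DiffFieldAt E ξ x := h.smooth_xi.mdifferentiable (by simp) x
  have h0 : (fun y ↦ φ y (ξ y)) = 0 := funext h.phi_xi
  have h1 := h.nabla_phi X ξ x hX hξ
  rw [h0, (leviCivita g).zero, ← h.eta_eq, h.eta_phi, h.eta_xi, zero_smul, one_smul] at h1
  have h2 : φ x (leviCivita g ξ x (X x)) = φ x (X x) := by simpa using h1
  have h3 : η x (leviCivita g ξ x (X x)) = 0 := by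
    have h4 := leviCivita_metric g hX hξ hξ
    have h5 : pair g ξ ξ = fun _ ↦ 1 := funext h.inner_xi_xi
    rw [h5, mvfderiv_const, g.symm x (ξ x), ← h.eta_eq] at h4
    simp only [_root_.zero_apply] at h4
    linarith
  have h6 := congrArg (φ x) h2
  rw [h.phi_phi, h.phi_phi, h3, zero_smul, add_zero, h.eta_eq] at h6
  rw [← neg_inj, h6]
  abel

theorem sum_inner_dualTangentBasis (g : Metric E M) (x : M) :
    ∑ i, g.inner x (tangentBasis E x i) (dualTangentBasis g x i) = finrank ℝ E := by
  have : FiniteDimensional ℝ (TangentSpace 𝓘(ℝ, E) x) := inferInstanceAs (FiniteDimensional ℝ E)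
  have : T2Space (TangentSpace 𝓘(ℝ, E) x) := inferInstanceAs (T2Space E)
  have h : ∀ i, g.inner x (tangentBasis E x i) (dualTangentBasis g x i) = 1 := fun i ↦ by
    have h1 := congrArg (fun l ↦ l (tangentBasis E x i)) ((flat g x).apply_symm_apply
      (LinearMap.toContinuousLinearMap ((tangentBasis E x).coord i)))
    rw [g.symm]
    exact h1.trans (by simp)
  simp [h]

theorem scalarCurvature_eq_of_ricci_eq {x : M} {c : ℝ}
    (h : ∀ v w, ricci g x v w = c * g.inner x v w) :
    scalarCurvature g x = c * finrank ℝ E := by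
  simp only [scalarCurvature, h, ← Finset.mul_sum, sum_inner_dualTangentBasis]

theorem isSolitonField [T2Space M] {n : ℕ} (hn : 1 ≤ n) (hdim : finrank ℝ E = 2 * n + 1)
    (hK : IsKenmotsu g φ ξ η) {V : Π x : M, TangentSpace 𝓘(ℝ, E) x} {lam mu p : ℝ}
    (hsol : IsConformalEtaRicciSoliton g η V lam mu p) {α β : SmoothFunctions E M}
    (hS : ∀ x v w, ricci g x v w = α x * g.inner x v w + β x * (η x v * η x w)) :
    (metricConnection g).IsSolitonField ⟨ξ, hK.smooth_xi⟩ n α β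
      (algebraMap ℝ _ (lam - (p + 2 / (finrank ℝ E : ℝ)) / 2)) (algebraMap ℝ _ mu)
      ⟨V, hsol.smooth⟩ where
  inner_self := by
    ext x
    exact hK.inner_xi_xi x
  conn_eq X := by
    ext x
    exact hK.leviCivita_xi X.mdifferentiableAt
  ne_zero := by omega
  hasLocalFrames := hdim ▸ hasLocalFrames g
  isTrace_curv Y Z := hdim ▸ isTrace_curv g Y Z _ fun x ↦ by
    rw [hS, hK.eta_eq, hK.eta_eq]
    rfl
  der_left X := Derivation.map_algebraMap _ _
  der_right X := Derivation.map_algebraMap _ _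
  lieInner_eq X Y := by
    have h2 : (2 : SmoothFunctions E M) = algebraMap ℝ _ 2 := (map_ofNat _ 2).symm
    rw [MetricConnection.lieInner_eq, metricConnection_bracket, metricConnection_bracket, h2]
    ext x
    have h := hsol.equation X Y x X.mdifferentiableAt Y.mdifferentiableAt
    rw [hS, hK.eta_eq, hK.eta_eq] at h
    show lieDerivMetric g V X Y x =
      -2 * (α x + (lam - (p + 2 / (finrank ℝ E : ℝ)) / 2)) * g.inner x (X x) (Y x)
      - 2 * (β x + mu) * (g.inner x (X x) (ξ x) * g.inner x (Y x) (ξ x))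
    linear_combination h

theorem ricci_eq_of_isConformalEtaRicciSoliton [T2Space M] {n : ℕ} (hn : 1 ≤ n)
    (hdim : finrank ℝ E = 2 * n + 1) (hK : IsKenmotsu g φ ξ η) (hE : IsEtaEinstein g η)
    {V : Π x : M, TangentSpace 𝓘(ℝ, E) x} {lam mu p : ℝ}
    (hsol : IsConformalEtaRicciSoliton g η V lam mu p) (x : M) (v w : TangentSpace 𝓘(ℝ, E) x) :
    ricci g x v w = -2 * n * g.inner x v w := by
  obtain ⟨α, β, hα, hβ, hS⟩ := hE
  have h := isSolitonField (α := ⟨α, hα⟩) (β := ⟨β, hβ⟩) hn hdim hK hsol hS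
  have hβ0 := h.isTransverseSoliton.beta_eq_zero
  have hα0 := h.eq_sub
  rw [hβ0, sub_zero, show (-2 * n : SmoothFunctions E M) = algebraMap ℝ _ (-2 * n) by
    rw [map_mul, map_neg, map_ofNat, map_natCast]] at hα0
  have h1 : α x = -2 * n := congrArg (fun f : SmoothFunctions E M ↦ f x) hα0
  have h2 : β x = 0 := congrArg (fun f : SmoothFunctions E M ↦ f x) hβ0
  rw [hS, h1, h2, zero_mul, add_zero]

end Kenmotsu

end KenmotsuGeometry

end

theorem einstein_of_eta_einstein_conformal_eta_ricci_soliton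
    {E : Type*} [NormedAddCommGroup E] [NormedSpace ℝ E] [FiniteDimensional ℝ E]
    {M : Type*} [TopologicalSpace M] [T2Space M] [SecondCountableTopology M]
    [ChartedSpace E M] [IsManifold 𝓘(ℝ, E) ∞ M]
    (n : ℕ) (hn : 1 ≤ n) (hdim : Module.finrank ℝ E = 2 * n + 1)
    (g : KenmotsuGeometry.Metric E M)
    (φ : Π x : M, TangentSpace 𝓘(ℝ, E) x →L[ℝ] TangentSpace 𝓘(ℝ, E) x)
    (ξ : Π x : M, TangentSpace 𝓘(ℝ, E) x)
    (η : Π x : M, TangentSpace 𝓘(ℝ, E) x →L[ℝ] ℝ)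
    (hK : KenmotsuGeometry.IsKenmotsu g φ ξ η) (hE : KenmotsuGeometry.IsEtaEinstein g η)
    (V : Π x : M, TangentSpace 𝓘(ℝ, E) x) (lam mu p : ℝ)
    (hsol : KenmotsuGeometry.IsConformalEtaRicciSoliton g η V lam mu p) :
    KenmotsuGeometry.IsEinstein g ∧
      ∀ (x : M) (v w : TangentSpace 𝓘(ℝ, E) x),
        KenmotsuGeometry.ricci g x v w = (KenmotsuGeometry.scalarCurvature g x / (2 * (n : ℝ)) + 1) * g.inner x v w := by
  have hr := KenmotsuGeometry.ricci_eq_of_isConformalEtaRicciSoliton hn hdim hK hE hsol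
  refine ⟨⟨fun _ ↦ -2 * n, contMDiff_const, hr⟩, fun x v w ↦ ?_⟩
  have hn0 : (n : ℝ) ≠ 0 := by exact_mod_cast (by omega : n ≠ 0)
  rw [KenmotsuGeometry.scalarCurvature_eq_of_ricci_eq (hr x), hr, hdim]
  congr 1
  push_cast
  field_simp
  ring
end

section
/- Let $(M,g)$ be a smooth Riemannian manifold of dimension $2n+1$ with Levi-Civita connection $\nabla$, and let $(M,g,\varphi,\xi,\eta)$ be a Kenmotsu manifold; that is, $\varphi$ is a smooth $(1,1)$-tensor field, $\xi$ a smooth vector field and $\eta$ a $1$-form on $M$ with $$\varphi^2=-I+\eta\otimes\xi,\quad \eta(\xi)=1,\quad \eta(X)=g(X,\xi),\quad g(\varphi X,\varphi Y)=g(X,Y)-\eta(X)\eta(Y),$$ $$(\nabla_X\varphi)Y=g(\varphi X,Y)\,\xi-\eta(Y)\,\varphi X$$ for all vector fields $X,Y$. Let $(g,V,\lambda,\mu)$ be a gradient conformal $\eta$-Ricci soliton with potential function $f$ on $M$; that is, $f$ is a smooth function on $M$, $V=Df=\operatorname{grad} f$, $\lambda,\mu$ are real constants, and for a real constant $p$ (the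 conformal pressure) $$\operatorname{Hess} f+S+\Big[\lambda-\Big(\frac p2+\frac1{2n+1}\Big)\Big]g+\mu\,\eta\otimes\eta=0,$$ where $\operatorname{Hess} f(X,Y)=g(\nabla_X Df,Y)$ is the Hessian of $f$ and $S$ is the Ricci tensor of $g$. Then $$g(R(X,Y)Df,\xi)=0$$ for all smooth vector fields $X,Y$ on $M$, where $R(X,Y)Z=\nabla_X\nabla_YZ-\nabla_Y\nabla_XZ-\nabla_{[X,Y]}Z$ is the Riemannian curvature tensor. -/
open Bundle VectorField
open scoped Manifold ContDiff Topology

noncomputable section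

namespace KenmotsuSoliton

variable {E : Type*} [NormedAddCommGroup E] [NormedSpace ℝ E] [FiniteDimensional ℝ E]
  {H : Type*} [TopologicalSpace H] {I : ModelWithCorners ℝ E H}
  {M : Type*} [TopologicalSpace M] [ChartedSpace H M] [IsManifold I ∞ M]

/-- A (not necessarily smooth) vector field on `M`. -/
abbrev VF (I : ModelWithCorners ℝ E H) (M : Type*) [TopologicalSpace M] [ChartedSpace H M] :=
  (x : M) → TangentSpace I x

/-- `X` is a smooth vector field, i.e. a smooth section of the tangent bundle. -/
def SmoothVF (X : VF I M) : Prop :=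
  ContMDiff I I.tangent ∞ (fun x => (⟨x, X x⟩ : TangentBundle I M))

/-- `φ` is a smooth `(1,1)`-tensor field, i.e. a smooth section of `Hom(TM, TM)`. -/
def SmoothEndField (φ : (x : M) → TangentSpace I x →L[ℝ] TangentSpace I x) : Prop :=
  ContMDiff I (I.prod 𝓘(ℝ, E →L[ℝ] E)) ∞
    (fun x => TotalSpace.mk' (E →L[ℝ] E)
      (E := fun x : M => TangentSpace I x →L[ℝ] TangentSpace I x) x (φ x))

/-- A smooth Riemannian metric on `M`; the scalar product of `v w : TangentSpace I x` is
`g.inner x v w`. -/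
abbrev Metric (I : ModelWithCorners ℝ E H) (M : Type*) [TopologicalSpace M]
    [ChartedSpace H M] [IsManifold I ∞ M] :=
  ContMDiffRiemannianMetric I ∞ E (TangentSpace I : M → Type _)

/-- An affine connection on `M`. In Mathlib's convention the covariant derivative
`(∇_X Y)(x)` is written `D Y x (X x)`. -/
abbrev Connection (I : ModelWithCorners ℝ E H) (M : Type*) [TopologicalSpace M]
    [ChartedSpace H M] [IsManifold I ∞ M] :=
  CovariantDerivative I E (TangentSpace I : M → Type _)

/-- The vector field `∇_X Y`. -/
def nabla (D : Connection I M) (X Y : VF I M) : VF I M :=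
  fun x => D Y x (X x)

/-- `D` is the Levi-Civita connection of the Riemannian metric `g`: the smooth affine connection
that is torsion-free and satisfies `u(g(Y, Z)) = g(∇_u Y, Z) + g(Y, ∇_u Z)` for all tangent vectors
`u` at `x` and all vector fields `Y`, `Z` that are differentiable at `x`. -/
structure IsLeviCivita (g : Metric I M) (D : Connection I M) : Prop where
  smooth : CovariantDerivative.ContMDiffCovariantDerivative D ∞
  torsion_free : D.torsion = 0
  metric : ∀ (Y Z : VF I M) (x : M),
    MDifferentiableAt I I.tangent (fun y => (⟨y, Y y⟩ : TangentBundle I M)) x →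
    MDifferentiableAt I I.tangent (fun y => (⟨y, Z y⟩ : TangentBundle I M)) x →
    ∀ u : TangentSpace I x,
      mvfderiv I (fun y => g.inner y (Y y) (Z y)) x u
        = g.inner x (D Y x u) (Z x) + g.inner x (Y x) (D Z x u)

/-- The curvature `R(X, Y)Z = ∇_X ∇_Y Z - ∇_Y ∇_X Z - ∇_{[X, Y]} Z`. -/
def curvature (D : Connection I M) (X Y Z : VF I M) : VF I M :=
  nabla D X (nabla D Y Z) - nabla D Y (nabla D X Z) - nabla D (mlieBracket I X Y) Z

instance finiteDimensional_tangentSpace (x : M) : FiniteDimensional ℝ (TangentSpace I x) :=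
  inferInstanceAs (FiniteDimensional ℝ E)

/-- The Ricci tensor `S(Y, Z)(x)`, the trace of the endomorphism `v ↦ R(v, Y)Z` of `T_x M`, computed
in a basis `(b i)` of `T_x M` as the sum of the `i`-th coordinates of `R(b i, Y)Z`. To form
`R(b i, Y)Z` the vector `b i` is extended to a vector field that is smooth near `x`; the value at `x`
depends neither on the extension nor on the basis. -/
def ricci (D : Connection I M) (Y Z : VF I M) (x : M) : ℝ :=
  let b := Module.finBasis ℝ (TangentSpace I x)
  ∑ i, b.coord i (curvature D (FiberBundle.extend E (b i)) Y Z x)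

theorem Metric.eq_of_inner_eq (g : Metric I M) (x : M) {u v : TangentSpace I x}
    (h : ∀ w, g.inner x u w = g.inner x v w) : u = v := by
  by_contra hne
  have h1 := g.pos x (u - v) (sub_ne_zero.mpr hne)
  have h2 : g.inner x (u - v) (u - v) = 0 := by
    rw [map_sub (g.inner x) u v]
    simp [h]
  exact h1.ne' h2

/-- The linear isomorphism `v ↦ g(v, ·)` between `T_x M` and its dual. -/
def Metric.flat (g : Metric I M) (x : M) :
    TangentSpace I x ≃ₗ[ℝ] Module.Dual ℝ (TangentSpace I x) :=
  LinearEquiv.ofInjectiveOfFinrankEq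
    { toFun := fun v => (g.inner x v : TangentSpace I x →ₗ[ℝ] ℝ)
      map_add' := fun u v => by ext w; simp
      map_smul' := fun c v => by ext w; simp }
    (fun _ _ h => Metric.eq_of_inner_eq g x fun w => LinearMap.congr_fun h w)
    Subspace.dual_finrank_eq.symm

/-- The gradient `Df` with respect to `g`: the vector field with `g(Df, v) = df(v)` for every
tangent vector `v`. -/
def grad (g : Metric I M) (f : M → ℝ) : VF I M :=
  fun x => (Metric.flat g x).symm (mvfderiv I f x : TangentSpace I x →ₗ[ℝ] ℝ)

/-- The defining property of the gradient. -/
theorem inner_grad (g : Metric I M) (f : M → ℝ) (x : M) (v : TangentSpace I x) :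
    g.inner x (grad g f x) v = mvfderiv I f x v :=
  LinearMap.congr_fun
    ((Metric.flat g x).apply_symm_apply (mvfderiv I f x : TangentSpace I x →ₗ[ℝ] ℝ)) v

/-- The Hessian `Hess f (X, Y) = g(∇_X Df, Y)`. -/
def hess (g : Metric I M) (D : Connection I M) (f : M → ℝ) (X Y : VF I M) (x : M) : ℝ :=
  g.inner x (nabla D X (grad g f) x) (Y x)

/-- `(φ, ξ, η)` is an almost contact metric structure on the Riemannian manifold `(M, g)`. The
`1`-form `η` is automatically smooth because it is the metric dual of `ξ`. -/
structure IsAlmostContactMetric (g : Metric I M)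
    (φ : (x : M) → TangentSpace I x →L[ℝ] TangentSpace I x)
    (ξ : VF I M) (η : (x : M) → TangentSpace I x →L[ℝ] ℝ) : Prop where
  smooth_phi : SmoothEndField φ
  smooth_xi : SmoothVF ξ
  phi_sq : ∀ (x : M) (v : TangentSpace I x), φ x (φ x v) = -v + η x v • ξ x
  eta_xi : ∀ x : M, η x (ξ x) = 1
  eta_eq : ∀ (x : M) (v : TangentSpace I x), η x v = g.inner x v (ξ x)
  inner_phi : ∀ (x : M) (v w : TangentSpace I x),
    g.inner x (φ x v) (φ x w) = g.inner x v w - η x v * η x w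

/-- `(φ, ξ, η)` is a Kenmotsu structure on the Riemannian manifold `(M, g)` with Levi-Civita
connection `D`: it is an almost contact metric structure with
`(∇_X φ)Y = g(φX, Y)ξ - η(Y)φX`, where `(∇_X φ)Y = ∇_X (φY) - φ(∇_X Y)`. At a point `x` both sides
depend on `X` only through the tangent vector `u = X x`. -/
structure IsKenmotsu (g : Metric I M) (D : Connection I M)
    (φ : (x : M) → TangentSpace I x →L[ℝ] TangentSpace I x)
    (ξ : VF I M) (η : (x : M) → TangentSpace I x →L[ℝ] ℝ) : Prop
    extends IsAlmostContactMetric g φ ξ η where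
  nabla_phi : ∀ Y : VF I M, SmoothVF Y → ∀ (x : M) (u : TangentSpace I x),
    D (fun y => φ y (Y y)) x u - φ x (D Y x u)
      = g.inner x (φ x u) (Y x) • ξ x - η x (Y x) • φ x u

/-- `(g, V, lam, mu)` is a gradient conformal `η`-Ricci soliton with potential function `f` and
conformal pressure `p` on the manifold `M` of dimension `m`, where `D` is the Levi-Civita connection
of `g`: `V` is a smooth vector field, `V = Df` for the smooth function `f`, and
`Hess f + S + [lam - (p / 2 + 1 / m)] g + mu η ⊗ η = 0`. -/
structure IsGradientConformalEtaRicciSoliton (g : Metric I M) (D : Connection I M)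
    (η : (x : M) → TangentSpace I x →L[ℝ] ℝ) (V : VF I M) (f : M → ℝ) (lam mu p : ℝ) (m : ℕ) :
    Prop where
  smooth_f : ContMDiff I 𝓘(ℝ) ∞ f
  smooth_V : SmoothVF V
  V_eq : V = grad g f
  soliton : ∀ X Y : VF I M, SmoothVF X → SmoothVF Y → ∀ x : M,
    hess g D f X Y x + ricci D X Y x + (lam - (p / 2 + 1 / (m : ℝ))) * g.inner x (X x) (Y x)
      + mu * (η x (X x) * η x (Y x)) = 0

end KenmotsuSoliton

end

noncomputable section

namespace KenmotsuSoliton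

variable {E : Type*} [NormedAddCommGroup E] [NormedSpace ℝ E]
  {H : Type*} [TopologicalSpace H] {I : ModelWithCorners ℝ E H}
  {M : Type*} [TopologicalSpace M] [ChartedSpace H M] [IsManifold I ∞ M]
  {g : Metric I M} {D : Connection I M}
  {φ : (x : M) → TangentSpace I x →L[ℝ] TangentSpace I x}
  {ξ : VF I M} {η : (x : M) → TangentSpace I x →L[ℝ] ℝ}

theorem SmoothVF.mdifferentiableAt {X : VF I M} (hX : SmoothVF X) (x : M) :
    MDifferentiableAt I I.tangent (fun y => (⟨y, X y⟩ : TangentBundle I M)) x :=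
  (hX x).mdifferentiableAt (by simp)

/-- The scalar product of two differentiable vector fields is differentiable. -/
theorem mdifferentiableAt_inner (g : Metric I M) {Y Z : VF I M} {x : M}
    (hY : MDifferentiableAt I I.tangent (fun y => (⟨y, Y y⟩ : TangentBundle I M)) x)
    (hZ : MDifferentiableAt I I.tangent (fun y => (⟨y, Z y⟩ : TangentBundle I M)) x) :
    MDifferentiableAt I 𝓘(ℝ) (fun y => g.inner y (Y y) (Z y)) x := by
  have h : MDifferentiableAt I (I.prod 𝓘(ℝ))
      (fun y => TotalSpace.mk' ℝ (E := Bundle.Trivial M ℝ) y (g.inner y (Y y) (Z y))) x :=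
    MDifferentiableAt.clm_bundle_apply₂ (F₁ := E) (F₂ := E) (b := fun y : M => y)
      ((g.contMDiff x).mdifferentiableAt (by simp)) hY hZ
  exact ((mdifferentiableAt_totalSpace ..).mp h).2

theorem IsAlmostContactMetric.phi_xi (h : IsAlmostContactMetric g φ ξ η) (x : M) :
    φ x (ξ x) = 0 := by
  by_contra hne
  have hpos := g.pos x _ hne
  rw [h.inner_phi, ← h.eta_eq, h.eta_xi] at hpos
  norm_num at hpos

theorem IsAlmostContactMetric.xi_ne_zero (h : IsAlmostContactMetric g φ ξ η) (x : M) :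
    ξ x ≠ 0 := fun h0 => by simpa [h0] using h.eta_xi x

theorem IsAlmostContactMetric.inner_xi_xi (h : IsAlmostContactMetric g φ ξ η) (x : M) :
    g.inner x (ξ x) (ξ x) = 1 := by
  rw [← h.eta_eq, h.eta_xi]

theorem IsAlmostContactMetric.mdifferentiableAt_eta (h : IsAlmostContactMetric g φ ξ η)
    {Y : VF I M} {x : M}
    (hY : MDifferentiableAt I I.tangent (fun y => (⟨y, Y y⟩ : TangentBundle I M)) x) :
    MDifferentiableAt I 𝓘(ℝ) (fun y => η y (Y y)) x := by
  simpa only [h.eta_eq] using mdifferentiableAt_inner g hY (h.smooth_xi.mdifferentiableAt x)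

variable [FiniteDimensional ℝ E]

theorem SmoothVF.mlieBracket {X Y : VF I M} (hX : SmoothVF X) (hY : SmoothVF Y) :
    SmoothVF (mlieBracket I X Y) := by
  have : CompleteSpace E := FiniteDimensional.complete ℝ E
  have : IsManifold I (minSmoothness ℝ 2) M := by
    rw [minSmoothness_of_isRCLikeNormedField]
    exact IsManifold.of_le (n := ∞) ENat.LEInfty.out
  have : IsManifold I ((⊤ : ℕ∞) + 1) M := by simpa using! ‹IsManifold I ∞ M›
  exact ContDiff.mlieBracket_vectorField (m := ⊤) (n := ⊤) hX hY (by simp)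

theorem IsLeviCivita.smoothVF_nabla (hD : IsLeviCivita g D) {X Y : VF I M} (hX : SmoothVF X)
    (hY : SmoothVF Y) :
    SmoothVF (nabla D X Y) := by
  have h := hD.smooth.contMDiff.contMDiff (σ := Y) (by simpa using! hY.contMDiffOn)
  rw [contMDiffOn_univ] at h
  exact h.clm_bundle_apply hX

theorem IsLeviCivita.sub_eq_mlieBracket (hD : IsLeviCivita g D) {X Y : VF I M} {x : M}
    (hX : MDifferentiableAt I I.tangent (fun y => (⟨y, X y⟩ : TangentBundle I M)) x)
    (hY : MDifferentiableAt I I.tangent (fun y => (⟨y, Y y⟩ : TangentBundle I M)) x) :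
    D Y x (X x) - D X x (Y x) = mlieBracket I X Y x :=
  D.torsion_eq_zero_iff.mp hD.torsion_free hX hY

/-- A Lie bracket acts on functions as the commutator of derivations. The auxiliary field `W` that
does not vanish at `x` serves to read off coefficients in the Jacobi identity for `X`, `Y`, `f W`. -/
theorem mvfderiv_mlieBracket {X Y W : VF I M} {f : M → ℝ} {x : M} (hX : SmoothVF X)
    (hY : SmoothVF Y) (hW : SmoothVF W) (hWx : W x ≠ 0) (hf : ContMDiff I 𝓘(ℝ) ∞ f)
    (hXf : MDifferentiableAt I 𝓘(ℝ) (fun y => mvfderiv I f y (X y)) x)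
    (hYf : MDifferentiableAt I 𝓘(ℝ) (fun y => mvfderiv I f y (Y y)) x) :
    mvfderiv I f x (mlieBracket I X Y x)
      = mvfderiv I (fun y => mvfderiv I f y (Y y)) x (X x)
        - mvfderiv I (fun y => mvfderiv I f y (X y)) x (Y x) := by
  have : CompleteSpace E := FiniteDimensional.complete ℝ E
  have hI2 : IsManifold I 2 M := IsManifold.of_le (n := ∞) ENat.LEInfty.out
  have hI3 : IsManifold I (minSmoothness ℝ 3) M := by
    rw [minSmoothness_of_isRCLikeNormedField]
    exact IsManifold.of_le (n := ∞) ENat.LEInfty.out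
  have hle : minSmoothness ℝ 2 ≤ (∞ : WithTop ℕ∞) := by
    rw [minSmoothness_of_isRCLikeNormedField]; exact ENat.LEInfty.out
  have hfd : ∀ y, MDifferentiableAt I 𝓘(ℝ) f y := fun y => (hf y).mdifferentiableAt (by simp)
  have hfW : SmoothVF (f • W) := hf.smul_section hW
  have hXW := hX.mlieBracket hW
  have hYW := hY.mlieBracket hW
  have expand : ∀ Z : VF I M, mlieBracket I Z (f • W)
      = (fun y => mvfderiv I f y (Z y)) • W + f • mlieBracket I Z W := fun Z => by
    ext y
    exact mlieBracket_smul_right (hfd y) (hW.mdifferentiableAt y)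
  have jac := leibniz_identity_mlieBracket_apply ((hX x).of_le hle) ((hY x).of_le hle)
    ((hfW x).of_le hle)
  have jacW := leibniz_identity_mlieBracket_apply ((hX x).of_le hle) ((hY x).of_le hle)
    ((hW x).of_le hle)
  rw [expand X, expand Y,
    mlieBracket_add_right (hYf.smul_section (hW.mdifferentiableAt x))
      ((hfd x).smul_section (hYW.mdifferentiableAt x)),
    mlieBracket_add_right (hXf.smul_section (hW.mdifferentiableAt x))
      ((hfd x).smul_section (hXW.mdifferentiableAt x)),
    mlieBracket_smul_right hYf (hW.mdifferentiableAt x),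
    mlieBracket_smul_right hXf (hW.mdifferentiableAt x),
    mlieBracket_smul_right (hfd x) (hW.mdifferentiableAt x),
    mlieBracket_smul_right (hfd x) (hXW.mdifferentiableAt x),
    mlieBracket_smul_right (hfd x) (hYW.mdifferentiableAt x), jacW] at jac
  have key : (mvfderiv I f x (mlieBracket I X Y x)
      - (mvfderiv I (fun y => mvfderiv I f y (Y y)) x (X x)
        - mvfderiv I (fun y => mvfderiv I f y (X y)) x (Y x))) • W x = 0 := by
    rw [← sub_eq_zero] at jac
    rw [← neg_eq_zero, ← jac]
    module
  exact sub_eq_zero.mp ((smul_eq_zero.mp key).resolve_right hWx)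

/-- On a Kenmotsu manifold, `∇_u ξ = u - η(u) ξ`. -/
theorem IsKenmotsu.nabla_xi (hD : IsLeviCivita g D) (hK : IsKenmotsu g D φ ξ η) (x : M)
    (u : TangentSpace I x) : D ξ x u = u - η x u • ξ x := by
  have hξ := hK.smooth_xi.mdifferentiableAt x
  have horth : η x (D ξ x u) = 0 := by
    have h := hD.metric ξ ξ x hξ hξ u
    simp only [hK.inner_xi_xi, g.symm x (ξ x)] at h
    have hc : mvfderiv I (fun _ : M => (1 : ℝ)) x u = 0 := by
      rw [mvfderiv_const]; rfl
    rw [hc] at h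
    rw [hK.eta_eq]
    linarith
  have h := hK.nabla_phi ξ hK.smooth_xi x u
  have hzero : (fun y => φ y (ξ y)) = (0 : VF I M) := funext hK.phi_xi
  rw [hzero, CovariantDerivative.zero] at h
  simp only [Pi.zero_apply, zero_apply, zero_sub] at h
  have hφ : φ x (D ξ x u) = φ x u := by
    have hη : g.inner x (φ x u) (ξ x) = 0 := by
      have h1 := hK.phi_sq x (φ x u)
      rw [hK.phi_sq x u, map_add, map_neg, map_smul, hK.phi_xi, smul_zero, add_zero,
        left_eq_add, smul_eq_zero] at h1
      rw [← hK.eta_eq]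
      exact h1.resolve_right (hK.xi_ne_zero x)
    rw [hη, hK.eta_xi] at h
    simpa using h
  have h2 := congrArg (φ x) hφ
  rw [hK.phi_sq, hK.phi_sq, horth, zero_smul, add_zero] at h2
  rw [← neg_neg (D ξ x u), h2]
  abel

/-- On a Kenmotsu manifold the `1`-form `η` is closed. -/
theorem IsKenmotsu.mvfderiv_eta_sub (hD : IsLeviCivita g D) (hK : IsKenmotsu g D φ ξ η)
    {X Y : VF I M} {x : M}
    (hX : MDifferentiableAt I I.tangent (fun y => (⟨y, X y⟩ : TangentBundle I M)) x)
    (hY : MDifferentiableAt I I.tangent (fun y => (⟨y, Y y⟩ : TangentBundle I M)) x) :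
    mvfderiv I (fun y => η y (Y y)) x (X x) - mvfderiv I (fun y => η y (X y)) x (Y x)
      = η x (mlieBracket I X Y x) := by
  have hξ := hK.smooth_xi.mdifferentiableAt x
  have h1 := hD.metric Y ξ x hY hξ (X x)
  have h2 := hD.metric X ξ x hX hξ (Y x)
  simp only [← hK.eta_eq, hK.nabla_xi hD, map_sub, map_smul, smul_eq_mul] at h1 h2
  rw [h1, h2, ← hD.sub_eq_mlieBracket hX hY, map_sub, g.symm x (X x) (Y x)]
  ring

/-- On a Kenmotsu manifold, `R(X, Y)ξ = η(X)Y - η(Y)X`. -/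
theorem IsKenmotsu.curvature_xi (hD : IsLeviCivita g D) (hK : IsKenmotsu g D φ ξ η)
    {X Y : VF I M} {x : M}
    (hX : MDifferentiableAt I I.tangent (fun y => (⟨y, X y⟩ : TangentBundle I M)) x)
    (hY : MDifferentiableAt I I.tangent (fun y => (⟨y, Y y⟩ : TangentBundle I M)) x) :
    curvature D X Y ξ x = η x (X x) • Y x - η x (Y x) • X x := by
  have hξ := hK.smooth_xi.mdifferentiableAt x
  have second : ∀ {Z : VF I M} (u : TangentSpace I x),
      MDifferentiableAt I I.tangent (fun y => (⟨y, Z y⟩ : TangentBundle I M)) x →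
      D (nabla D Z ξ) x u = D Z x u - (η x (Z x) • (u - η x u • ξ x)
        + mvfderiv I (fun y => η y (Z y)) x u • ξ x) := by
    intro Z u hZ
    have hη : MDifferentiableAt I 𝓘(ℝ) (fun y => - η y (Z y)) x :=
      (hK.mdifferentiableAt_eta hZ).neg
    have hZξ : nabla D Z ξ = Z + (fun y => - η y (Z y)) • ξ := by
      ext y
      simp [nabla, hK.nabla_xi hD, sub_eq_add_neg]
    rw [hZξ, D.isCovariantDerivativeOnUniv.add hZ (hη.smul_section hξ),
      D.isCovariantDerivativeOnUniv.leibniz hξ hη, mvfderiv_fun_neg]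
    simp only [add_apply, smul_apply, ContinuousLinearMap.smulRight_apply, neg_apply, hK.nabla_xi hD]
    module
  have hT := hD.sub_eq_mlieBracket hX hY
  have hdη := hK.mvfderiv_eta_sub hD hX hY
  change D (nabla D Y ξ) x (X x) - D (nabla D X ξ) x (Y x) - D ξ x (mlieBracket I X Y x) = _
  rw [second _ hY, second _ hX, hK.nabla_xi hD, ← hdη, ← hT]
  module

/-- On a Kenmotsu manifold of dimension `m`, `S(X, ξ) = (1 - m) η(X)`. -/
theorem IsKenmotsu.ricci_xi (hD : IsLeviCivita g D) (hK : IsKenmotsu g D φ ξ η)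
    {X : VF I M} {x : M}
    (hX : MDifferentiableAt I I.tangent (fun y => (⟨y, X y⟩ : TangentBundle I M)) x) :
    ricci D X ξ x = (1 - Module.finrank ℝ E) * η x (X x) := by
  unfold ricci
  simp only [hK.curvature_xi hD (FiberBundle.mdifferentiableAt_extend ..) hX,
    FiberBundle.extend_apply_self, map_sub, map_smul, smul_eq_mul, Finset.sum_sub_distrib]
  set b := Module.finBasis ℝ (TangentSpace I x)
  have h1 : ∑ i, η x (b i) * b.coord i (X x) = η x (X x) := by
    conv_rhs => rw [← b.sum_repr (X x), map_sum]
    exact Finset.sum_congr rfl fun i _ => by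
      rw [map_smul, smul_eq_mul, mul_comm, Module.Basis.coord_apply]
  have h2 : ∑ i, η x (X x) * b.coord i (b i) = Module.finrank ℝ E * η x (X x) := by
    simp only [Module.Basis.coord_apply, Module.Basis.repr_self, Finsupp.single_eq_same, mul_one,
      Finset.sum_const, Finset.card_univ, Fintype.card_fin, nsmul_eq_mul]
    rfl
  rw [h1, h2]
  ring

/-- The Hessian is symmetric. The field `W` that does not vanish at `x` is auxiliary. -/
theorem IsLeviCivita.hess_comm (hD : IsLeviCivita g D) {f : M → ℝ}
    (hf : ContMDiff I 𝓘(ℝ) ∞ f) (hgrad : SmoothVF (grad g f)) {X Y W : VF I M} {x : M}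
    (hX : SmoothVF X) (hY : SmoothVF Y) (hW : SmoothVF W) (hWx : W x ≠ 0) :
    hess g D f X Y x = hess g D f Y X x := by
  have hG := hgrad.mdifferentiableAt x
  have hXx := hX.mdifferentiableAt x
  have hYx := hY.mdifferentiableAt x
  have h1 := hD.metric (grad g f) Y x hG hYx (X x)
  have h2 := hD.metric (grad g f) X x hG hXx (Y x)
  have h3 := mvfderiv_mlieBracket (x := x) hX hY hW hWx hf
    (by simpa only [inner_grad] using mdifferentiableAt_inner g hG hXx)
    (by simpa only [inner_grad] using mdifferentiableAt_inner g hG hYx)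
  rw [← hD.sub_eq_mlieBracket hXx hYx, map_sub] at h3
  simp only [inner_grad] at h1 h2
  unfold hess nabla
  linarith

/-- If `g(∇_X Df, ξ) = k η(X)` for a constant `k` on a Kenmotsu manifold, then
`g(R(X, Y)Df, ξ) = 0`. -/
theorem IsKenmotsu.inner_curvature_grad_xi (hD : IsLeviCivita g D) (hK : IsKenmotsu g D φ ξ η)
    {f : M → ℝ} (hf : ContMDiff I 𝓘(ℝ) ∞ f) (hgrad : SmoothVF (grad g f)) {k : ℝ}
    (hk : ∀ X : VF I M, SmoothVF X → ∀ x, hess g D f X ξ x = k * η x (X x))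
    {X Y : VF I M} (hX : SmoothVF X) (hY : SmoothVF Y) (x : M) :
    g.inner x (curvature D X Y (grad g f) x) (ξ x) = 0 := by
  have hξ := hK.smooth_xi.mdifferentiableAt x
  have second : ∀ {Z : VF I M} (u : TangentSpace I x), SmoothVF Z →
      g.inner x (D (nabla D Z (grad g f)) x u) (ξ x)
        = k * mvfderiv I (fun y => η y (Z y)) x u - g.inner x (nabla D Z (grad g f) x) u
          + k * η x u * η x (Z x) := by
    intro Z u hZ
    have h := hD.metric (nabla D Z (grad g f)) ξ x
      ((hD.smoothVF_nabla hZ hgrad).mdifferentiableAt x) hξ u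
    have hfun : (fun y => g.inner y (nabla D Z (grad g f) y) (ξ y))
        = fun y => k * η y (Z y) := funext fun y => hk Z hZ y
    have hkx : g.inner x (nabla D Z (grad g f) x) (ξ x) = k * η x (Z x) := hk Z hZ x
    have hd : mvfderiv I (fun y => k * η y (Z y)) x u
        = k * mvfderiv I (fun y => η y (Z y)) x u := by
      rw [mvfderiv_fun_mul mdifferentiableAt_const
        (hK.mdifferentiableAt_eta (hZ.mdifferentiableAt x))]
      simp [mvfderiv_const]
    rw [hfun, hd, hK.nabla_xi hD, map_sub, map_smul, smul_eq_mul, hkx] at h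
    linarith
  have hsymm := hD.hess_comm hf hgrad hX hY hK.smooth_xi (hK.xi_ne_zero x)
  have hbr : g.inner x (D (grad g f) x (mlieBracket I X Y x)) (ξ x)
      = k * η x (mlieBracket I X Y x) := hk _ (hX.mlieBracket hY) x
  have hdη := hK.mvfderiv_eta_sub hD (hX.mdifferentiableAt x) (hY.mdifferentiableAt x)
  have hsplit : g.inner x (curvature D X Y (grad g f) x) (ξ x)
      = g.inner x (D (nabla D Y (grad g f)) x (X x)) (ξ x)
        - g.inner x (D (nabla D X (grad g f)) x (Y x)) (ξ x)
        - g.inner x (D (grad g f) x (mlieBracket I X Y x)) (ξ x) := by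
    change g.inner x (_ - _ - _) (ξ x) = _
    rw [map_sub, map_sub]
    rfl
  rw [hsplit, second _ hY, second _ hX, hbr, ← hdη]
  unfold hess at hsymm
  rw [hsymm]
  ring

end KenmotsuSoliton

end

theorem g_curvature_grad_xi_eq_zero_of_gradient_conformal_eta_ricci_soliton
    {n : ℕ} {M : Type*} [TopologicalSpace M] [T2Space M] [SigmaCompactSpace M]
    [ChartedSpace (EuclideanSpace ℝ (Fin (2 * n + 1))) M] [IsManifold (𝓡 (2 * n + 1)) ∞ M]
    (g : KenmotsuSoliton.Metric (𝓡 (2 * n + 1)) M)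
    (D : KenmotsuSoliton.Connection (𝓡 (2 * n + 1)) M)
    (φ : (x : M) → TangentSpace (𝓡 (2 * n + 1)) x →L[ℝ] TangentSpace (𝓡 (2 * n + 1)) x)
    (ξ : KenmotsuSoliton.VF (𝓡 (2 * n + 1)) M)
    (η : (x : M) → TangentSpace (𝓡 (2 * n + 1)) x →L[ℝ] ℝ)
    (hD : KenmotsuSoliton.IsLeviCivita g D)
    (hK : KenmotsuSoliton.IsKenmotsu g D φ ξ η)
    (V : KenmotsuSoliton.VF (𝓡 (2 * n + 1)) M) (f : M → ℝ) (lam mu p : ℝ)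
    (hsol : KenmotsuSoliton.IsGradientConformalEtaRicciSoliton g D η V f lam mu p (2 * n + 1))
    (X Y : KenmotsuSoliton.VF (𝓡 (2 * n + 1)) M)
    (hX : KenmotsuSoliton.SmoothVF X) (hY : KenmotsuSoliton.SmoothVF Y) (x : M) :
    g.inner x (KenmotsuSoliton.curvature D X Y (KenmotsuSoliton.grad g f) x) (ξ x) = 0 := by
  refine hK.inner_curvature_grad_xi hD hsol.smooth_f (hsol.V_eq ▸ hsol.smooth_V)
    (k := 2 * n - (lam - (p / 2 + 1 / ((2 * n + 1 : ℕ) : ℝ))) - mu) (fun Z hZ y => ?_) hX hY x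
  have h := hsol.soliton Z ξ hZ hK.smooth_xi y
  rw [hK.ricci_xi hD (hZ.mdifferentiableAt y), finrank_euclideanSpace_fin, ← hK.eta_eq,
    hK.eta_xi] at h
  push_cast at h ⊢
  linarith
end
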